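/- arXiv:2409.02765 — 6 statements merged into one kernel-verified Lean document; each statement's English description precedes it below -/
import Mathlib

section
/- The sequence ex₂(n, C₁₁)/n converges to 1/3 as n → ∞; that is, the codegree Turán density of the 3-uniform tight cycle C₁₁ equals 1/3. -/
open Finset

/-- A 3-uniform hypergraph given by its edge set: every edge has exactly 3 vertices. -/
def IsUniform3 {V : Type*} (H : Finset (Finset V)) : Prop :=
  ∀ e ∈ H, e.card = 3

/-- The codegree of a pair of vertices: the number of vertices `w` with `{u,v,w} ∈ H`. -/
noncomputable def codeg {V : Type*} [DecidableEq V] (H : Finset (Finset V)) (u v : V) : ℕ :=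
  {w : V | ({u, v, w} : Finset V) ∈ H}.ncard

/-- The minimum codegree `δ₂(H)`: the minimum of `codeg H u v` over pairs of distinct vertices. -/
noncomputable def minCodeg {V : Type*} [DecidableEq V] (H : Finset (Finset V)) : ℕ :=
  sInf {d : ℕ | ∃ u v : V, u ≠ v ∧ codeg H u v = d}

/-- `H` contains a homomorphic copy of the tight cycle `C_ℓ`: a cyclic sequence of vertices
(indexed by `ZMod ℓ`, not necessarily distinct) in which every three cyclically consecutive
vertices are pairwise distinct and form an edge of `H`. -/
def HasHomTightCycle {V : Type*} [DecidableEq V] (ℓ : ℕ) (H : Finset (Finset V)) : Prop :=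
  ∃ x : ZMod ℓ → V, ∀ i : ZMod ℓ,
    x (i - 1) ≠ x i ∧ x i ≠ x (i + 1) ∧ x (i - 1) ≠ x (i + 1) ∧
      ({x (i - 1), x i, x (i + 1)} : Finset V) ∈ H

/-- `H` contains a (genuine) copy of the tight cycle `C_ℓ`: `ℓ` distinct vertices, cyclically
ordered, such that every three cyclically consecutive vertices form an edge of `H`. -/
def HasTightCycle {V : Type*} [DecidableEq V] (ℓ : ℕ) (H : Finset (Finset V)) : Prop :=
  ∃ x : ZMod ℓ → V, Function.Injective x ∧
    ∀ i : ZMod ℓ, ({x (i - 1), x i, x (i + 1)} : Finset V) ∈ H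

/-- The arc `u → v` of the apex digraph `D`: some `K₄⁻` of `H` contains `u` and `v`
with apex `v`; i.e. there are two further vertices `a, b` (with `u,v,a,b` distinct)
such that the three edges through `v` on `{u,v,a,b}` all lie in `H`. -/
def ArcD {V : Type*} [DecidableEq V] (H : Finset (Finset V)) (u v : V) : Prop :=
  ∃ a b : V, ({u, v, a, b} : Finset V).card = 4 ∧
    ({v, u, a} : Finset V) ∈ H ∧ ({v, u, b} : Finset V) ∈ H ∧ ({v, a, b} : Finset V) ∈ H

/-- `{u,v}` is a base pair: some `K₄⁻` of `H` contains `u` and `v` with neither `u` nor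
`v` being the apex; i.e. there are further vertices `w, a` (with `u,v,w,a` distinct) with
apex `w`, so that the three edges through `w` on `{u,v,w,a}` all lie in `H`. -/
def BasePair {V : Type*} [DecidableEq V] (H : Finset (Finset V)) (u v : V) : Prop :=
  ∃ w a : V, ({u, v, w, a} : Finset V).card = 4 ∧
    ({w, u, v} : Finset V) ∈ H ∧ ({w, u, a} : Finset V) ∈ H ∧ ({w, v, a} : Finset V) ∈ H

/-- The degree of `v` in the base-pair graph `B`. -/
noncomputable def degB {V : Type*} [DecidableEq V] (H : Finset (Finset V)) (v : V) : ℕ :=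
  {u : V | BasePair H u v}.ncard

/-- The out-degree of `v` in the apex digraph `D`. -/
noncomputable def outDegD {V : Type*} [DecidableEq V] (H : Finset (Finset V)) (v : V) : ℕ :=
  {u : V | ArcD H v u}.ncard

/-- The in-degree of `v` in the apex digraph `D`. -/
noncomputable def inDegD {V : Type*} [DecidableEq V] (H : Finset (Finset V)) (v : V) : ℕ :=
  {u : V | ArcD H u v}.ncard

/-- The codegree Turán number `ex₂(n, C_ℓ)`: the maximum of `δ₂(H)` over all 3-uniform
hypergraphs `H` on `n` vertices containing no copy of the tight cycle `C_ℓ`. -/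
noncomputable def exCodeg (ℓ n : ℕ) : ℕ :=
  sSup {k : ℕ | ∃ H : Finset (Finset (Fin n)),
    IsUniform3 H ∧ ¬ HasTightCycle ℓ H ∧ minCodeg H = k}

theorem exists_zmod_eleven {V : Type*} (T : V → V → V → Prop) (a b c d e f g h i j k : V)
    (h1 : T a b c) (h2 : T b c d) (h3 : T c d e) (h4 : T d e f) (h5 : T e f g) (h6 : T f g h)
    (h7 : T g h i) (h8 : T h i j) (h9 : T i j k) (h10 : T j k a) (h11 : T k a b) :
    ∃ x : ZMod 11 → V, ∀ i, T (x (i - 1)) (x i) (x (i + 1)) := by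
  refine ⟨(![a, b, c, d, e, f, g, h, i, j, k] : Fin 11 → V), fun (i : Fin 11) => ?_⟩
  fin_cases i
  exacts [h11, h1, h2, h3, h4, h5, h6, h7, h8, h9, h10]

/-- A closed tight walk of length 11 exists in every symmetric ternary relation in which every
pair has codegree exceeding a third of the number of vertices. -/
theorem exists_closed_tight_walk {V : Type*} [Fintype V] (T : V → V → V → Prop)
    (swap : ∀ {a b c}, T a b c → T b a c) (rot : ∀ {a b c}, T a b c → T b c a)
    (irr : ∀ {a b c}, T a b c → a ≠ b)
    (deg : ∀ a b, a ≠ b → Fintype.card V < 3 * {c | T a b c}.ncard)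
    (hV : 3 ≤ Fintype.card V) :
    ∃ x : ZMod 11 → V, ∀ i, T (x (i - 1)) (x i) (x (i + 1)) := by
  classical
  by_contra hno
  let A : V → V → V → Prop := fun u v w => T u v w ∧ ∃ a, T w u a ∧ T w v a
  have A_symm : ∀ {u v w}, A u v w → A v u w := fun ⟨h, a, h1, h2⟩ => ⟨swap h, a, h2, h1⟩
  let D : V → V → Prop := fun u w => ∃ v, A u v w
  let B : V → V → Prop := fun u v => ∃ w, A u v w
  have B_symm : ∀ {u v}, B u v → B v u := fun ⟨w, h⟩ => ⟨w, A_symm h⟩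
  have apex : ∀ {u v w}, T u v w → A u v w ∨ A v w u ∨ A u w v := by
    intro u v w h
    by_contra! hc
    obtain ⟨n1, n2, n3⟩ := hc
    have d1 : Disjoint {c | T w u c} {c | T w v c} :=
      Set.disjoint_left.2 fun x hx hy => n1 ⟨h, x, hx, hy⟩
    have d2 : Disjoint {c | T w u c} {c | T u v c} :=
      Set.disjoint_left.2 fun x hx hy => n2 ⟨rot h, x, hy, swap hx⟩
    have d3 : Disjoint {c | T w v c} {c | T u v c} :=
      Set.disjoint_left.2 fun x hx hy => n3 ⟨swap (rot (rot h)), x, swap hy, swap hx⟩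
    have e1 := deg w u (irr (rot (rot h)))
    have e2 := deg w v (irr (rot h)).symm
    have e3 := deg u v (irr h)
    have c1 := Set.ncard_union_eq d1
    have c2 := Set.ncard_union_eq (Set.disjoint_union_left.2 ⟨d2, d3⟩)
    have c3 := Set.ncard_le_card (({c | T w u c} ∪ {c | T w v c}) ∪ {c | T u v c})
    rw [Nat.card_eq_fintype_card] at c3
    omega
  have not_D_D : ∀ {u w}, D u w → D w u → False := by
    rintro u w ⟨v, h1, a, h2, h3⟩ ⟨v', k1, a', k2, k3⟩
    apply hno
    apply exists_zmod_eleven T u w v u w v a w u v' a' <;>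
      first
        | assumption
        | (apply rot; assumption)
        | (apply rot; apply rot; assumption)
        | (apply swap; assumption)
        | (apply swap; apply rot; assumption)
        | (apply swap; apply rot; apply rot; assumption)
  have not_D_B : ∀ {u v}, D u v → B u v → False := by
    rintro u v ⟨b, h1, c, h2, h3⟩ ⟨w, k1, a, k2, k3⟩
    apply hno
    apply exists_zmod_eleven T u v w a u w v u b v c <;>
      first
        | assumption
        | (apply rot; apply rot; assumption)
        | (apply swap; assumption)
        | (apply swap; apply rot; assumption)
        | (apply swap; apply rot; apply rot; assumption)
  have of_D : ∀ {u w v}, D u w → T u w v → D v w ∧ B u v := by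
    intro u w v hD hT
    rcases apex hT with h | h | h
    · exact (not_D_B hD ⟨v, h⟩).elim
    · exact (not_D_D hD ⟨v, h⟩).elim
    · exact ⟨⟨u, A_symm h⟩, ⟨w, h⟩⟩
  have of_B : ∀ {u v w}, B u v → T u v w → D u w := by
    intro u v w hB hT
    rcases apex hT with h | h | h
    · exact ⟨v, h⟩
    · exact (not_D_B ⟨w, h⟩ (B_symm hB)).elim
    · exact (not_D_B ⟨w, h⟩ hB).elim
  have nonempty : ∀ {a b}, a ≠ b → ∃ c, T a b c := by
    intro a b hab
    have := deg a b hab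
    exact Set.nonempty_of_ncard_ne_zero (s := {c | T a b c}) (by omega)
  have D_ne : ∀ {u w}, D u w → u ≠ w := fun ⟨v, h, _⟩ => (irr (rot (rot h))).symm
  have B_ne : ∀ {u w}, B u w → u ≠ w := fun ⟨v, h, _⟩ => irr h
  have trichotomy : ∀ {a b}, a ≠ b → D a b ∨ D b a ∨ B a b := by
    intro a b hab
    obtain ⟨c, hc⟩ := nonempty hab
    rcases apex hc with h | h | h
    · exact Or.inr (Or.inr ⟨c, h⟩)
    · exact Or.inr (Or.inl ⟨c, h⟩)
    · exact Or.inl ⟨c, h⟩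
  have B_of_D : ∀ {u w}, D u w → ∃ v, B u v := fun h =>
    (nonempty (D_ne h)).imp fun v hv => (of_D h hv).2
  have D_of_B : ∀ {u v}, B u v → ∃ w, D u w := fun h =>
    (nonempty (B_ne h)).imp fun v hv => of_B h hv
  have out_deg : ∀ {u v}, B u v → Fintype.card V < 3 * {w | D u w}.ncard := fun {u v} h =>
    (deg u v (B_ne h)).trans_le
      (Nat.mul_le_mul_left 3 (Set.ncard_le_ncard fun w hw => of_B h hw))
  have not_D_in_out : ∀ {x u w}, D x u → D u w → False := by
    intro x u w hx hw
    obtain ⟨v, hv⟩ := B_of_D hw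
    have e1 := out_deg hv
    have e2 : Fintype.card V < 3 * {y | D y u}.ncard := (deg x u (D_ne hx)).trans_le
      (Nat.mul_le_mul_left 3 (Set.ncard_le_ncard fun y hy => (of_D hx hy).1))
    have e3 : Fintype.card V < 3 * {y | B u y}.ncard := (deg u w (D_ne hw)).trans_le
      (Nat.mul_le_mul_left 3 (Set.ncard_le_ncard fun y hy => (of_D hw hy).2))
    have c1 := Set.ncard_union_eq (s := {y | D u y}) (t := {y | D y u})
      (Set.disjoint_left.2 fun y hy hy' => not_D_D hy hy')
    have c2 := Set.ncard_union_eq (s := {y | D u y} ∪ {y | D y u}) (t := {y | B u y})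
      (Set.disjoint_left.2 fun y hy hy' =>
        hy.elim (fun h => not_D_B h hy') fun h => not_D_B h (B_symm hy'))
    have c3 := Set.ncard_le_card (({y | D u y} ∪ {y | D y u}) ∪ {y | B u y})
    rw [Nat.card_eq_fintype_card] at c3
    omega
  obtain ⟨a, b, hab⟩ := Fintype.exists_pair_of_one_lt_card (α := V) (by omega)
  obtain ⟨u, v, w, huv⟩ : ∃ u v w, A u v w := by
    obtain ⟨c, hc⟩ := nonempty hab
    rcases apex hc with h | h | h <;> exact ⟨_, _, _, h⟩
  have huw : D u w := ⟨v, huv⟩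
  have hcard := out_deg (u := u) (v := v) ⟨w, huv⟩
  obtain ⟨x, hx, hxw⟩ := Set.exists_ne_of_one_lt_ncard (s := {w | D u w}) (by omega) w
  rcases trichotomy hxw with h | h | h
  · exact not_D_in_out hx h
  · exact not_D_in_out huw h
  · obtain ⟨z, hz⟩ := D_of_B (B_symm h)
    exact not_D_in_out huw hz

theorem card_not_injective_le {α β : Type*} [Fintype α] [Fintype β] [DecidableEq α]
    (hβ : 0 < Fintype.card β) :
    (({f : α → β | ¬ Function.Injective f}.ncard : ℕ) : ℝ) ≤
      (Fintype.card α : ℝ) ^ 2 / Fintype.card β * (Fintype.card β : ℝ) ^ Fintype.card α := by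
  classical
  set k := Fintype.card α with hk
  set n := Fintype.card β with hn
  have hn0 : (0 : ℝ) < n := by exact_mod_cast hβ
  have hinj : {f : α → β | Function.Injective f}.ncard = n.descFactorial k := by
    rw [← Fintype.card_embedding_eq, ← Nat.card_coe_set_eq, ← Nat.card_eq_fintype_card]
    exact Nat.card_congr (Equiv.subtypeInjectiveEquivEmbedding α β)
  have hadd := Set.ncard_add_ncard_compl {f : α → β | Function.Injective f}
  rw [hinj, Nat.card_eq_fintype_card, Fintype.card_fun, ← hk, ← hn, Set.compl_ofPred] at hadd
  have hadd' : ((n.descFactorial k : ℕ) : ℝ) +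
      (({f : α → β | ¬ Function.Injective f}.ncard : ℕ) : ℝ) = (n : ℝ) ^ k := by
    exact_mod_cast hadd
  have hdesc : (1 - (k : ℝ) ^ 2 / n) * (n : ℝ) ^ k ≤ n.descFactorial k := by
    rcases le_or_gt k n with hkn | hkn
    · have h1 : ((n - k : ℕ) : ℝ) ^ k ≤ n.descFactorial k := by
        exact_mod_cast (Nat.pow_le_pow_left (by omega) k).trans (Nat.pow_sub_le_descFactorial n k)
      have h2 := one_add_mul_le_pow (a := -((k : ℝ) / n)) (by
        have : (k : ℝ) / n ≤ 1 := (div_le_one hn0).2 (by exact_mod_cast hkn)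
        linarith) k
      calc (1 - (k : ℝ) ^ 2 / n) * (n : ℝ) ^ k
          = (1 + k * (-((k : ℝ) / n))) * (n : ℝ) ^ k := by ring
        _ ≤ (1 + -((k : ℝ) / n)) ^ k * (n : ℝ) ^ k := by gcongr
        _ = ((n - k : ℕ) : ℝ) ^ k := by
            rw [← mul_pow, Nat.cast_sub hkn]
            congr 1
            field_simp
            ring
        _ ≤ _ := h1
    · have h1 : (1 : ℝ) ≤ (k : ℝ) ^ 2 / n := by
        rw [one_le_div hn0]
        have : n ≤ k ^ 2 := by nlinarith
        exact_mod_cast this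
      have h2 : (0 : ℝ) ≤ (n : ℝ) ^ k := by positivity
      have h3 : (0 : ℝ) ≤ n.descFactorial k := by positivity
      nlinarith
  linarith

/-- A dense family of `k`-tuples contains a complete `k`-partite family with parts of size
`t + 1`. -/
theorem exists_complete_partite (t k : ℕ) : ∀ c : ℝ, 0 < c → ∃ N : ℕ, ∀ n : ℕ, N ≤ n →
    ∀ S : Finset (Fin k → Fin n), c * (n : ℝ) ^ k ≤ #S →
      ∃ a : Fin k → Fin (t + 1) → Fin n, (∀ i, Function.Injective (a i)) ∧
        ∀ s : Fin k → Fin (t + 1), (fun i => a i (s i)) ∈ S := by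
  classical
  induction k with
  | zero =>
    intro c hc
    refine ⟨0, fun n _ S hS => ⟨fun i => i.elim0, fun i => i.elim0, fun s => ?_⟩⟩
    obtain ⟨f, hf⟩ : S.Nonempty := by
      rw [← card_pos]
      have : (0 : ℝ) < #S := by simp at hS; linarith
      exact_mod_cast this
    convert hf
  | succ k ih =>
    intro c hc
    obtain ⟨N, hN⟩ := ih (c ^ (t + 1) / 2) (by positivity)
    obtain ⟨M, hM⟩ := exists_nat_gt (2 * ((t : ℝ) + 1) ^ 2 / c ^ (t + 1))
    refine ⟨max N (max M 1), fun n hn S hS => ?_⟩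
    have hnN : N ≤ n := (le_max_left _ _).trans hn
    have hnM : M ≤ n := (le_max_left _ _).trans ((le_max_right _ _).trans hn)
    have hn1 : 1 ≤ n := (le_max_right _ _).trans ((le_max_right _ _).trans hn)
    have hn0 : (0 : ℝ) < n := by exact_mod_cast hn1
    let F : (Fin k → Fin n) → Finset (Fin n) := fun g => {v | (Fin.cons v g : Fin (k + 1) → Fin n) ∈ S}
    let G : (Fin (t + 1) → Fin n) → Finset (Fin k → Fin n) := fun τ => {g | ∀ j, τ j ∈ F g}
    have hF : ∑ g, #(F g) = #S := by
      calc ∑ g, #(F g) = ∑ g : Fin k → Fin n, ∑ v : Fin n,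
            if (Fin.cons v g : Fin (k + 1) → Fin n) ∈ S then 1 else 0 := by
              simp only [F, card_filter]
        _ = ∑ q : Fin n × (Fin k → Fin n),
            if (Fin.cons q.1 q.2 : Fin (k + 1) → Fin n) ∈ S then 1 else 0 := by
              rw [Fintype.sum_prod_type, sum_comm]
        _ = ∑ f : Fin (k + 1) → Fin n, if f ∈ S then 1 else 0 :=
              Fintype.sum_equiv (Fin.consEquiv fun _ => Fin n) _ _ fun q => rfl
        _ = #S := by simp
    have hFG : ∑ g, #(F g) ^ (t + 1) = ∑ τ, #(G τ) := by
      calc ∑ g, #(F g) ^ (t + 1)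
          = ∑ g, #({τ | ∀ j, τ j ∈ F g} : Finset (Fin (t + 1) → Fin n)) := by
            refine sum_congr rfl fun g _ => ?_
            rw [← Fintype.card_piFinset_const]
            congr 1
            ext τ
            simp [Fintype.mem_piFinset]
        _ = ∑ τ, #(G τ) := by
            simp only [G, card_filter]
            exact sum_comm
    have hpow : c ^ (t + 1) * (n : ℝ) ^ (k + (t + 1)) ≤ ∑ τ, (#(G τ) : ℝ) := by
      have h1 := pow_sum_div_card_le_sum_pow (s := univ) (f := fun g => (#(F g) : ℝ))
        (fun g _ => Nat.cast_nonneg _) t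
      rw [← Nat.cast_sum, hF, card_univ, Fintype.card_fun, Fintype.card_fin, Fintype.card_fin,
        div_le_iff₀ (by positivity)] at h1
      have h2 : (c * (n : ℝ) ^ (k + 1)) ^ (t + 1) ≤ (#S : ℝ) ^ (t + 1) := by gcongr
      have h3 : ∑ τ, (#(G τ) : ℝ) = ∑ g, (#(F g) : ℝ) ^ (t + 1) := by exact_mod_cast hFG.symm
      rw [h3]
      refine le_of_mul_le_mul_right (a := ((n ^ k : ℕ) : ℝ) ^ t) ?_ (by positivity)
      refine le_trans (le_of_eq ?_) (h2.trans h1)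
      push_cast
      ring
    obtain ⟨τ, hτ, hcard⟩ : ∃ τ, Function.Injective τ ∧ c ^ (t + 1) / 2 * (n : ℝ) ^ k ≤ #(G τ) := by
      by_contra! hcon
      have hle : ∀ τ, (#(G τ) : ℝ) ≤ c ^ (t + 1) / 2 * (n : ℝ) ^ k +
          if Function.Injective τ then 0 else (n : ℝ) ^ k := by
        intro τ
        split_ifs with hτ
        · linarith [hcon τ hτ]
        · have : #(G τ) ≤ n ^ k := (card_le_univ _).trans (by simp)
          have : (#(G τ) : ℝ) ≤ (n : ℝ) ^ k := by exact_mod_cast this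
          have : 0 ≤ c ^ (t + 1) / 2 * (n : ℝ) ^ k := by positivity
          linarith
      have hsum := sum_le_sum fun τ (_ : τ ∈ univ) => hle τ
      rw [sum_add_distrib, sum_ite, sum_const_zero, zero_add, sum_const, sum_const, card_univ,
        nsmul_eq_mul, nsmul_eq_mul, Fintype.card_fun, Fintype.card_fin, Fintype.card_fin] at hsum
      have hni := card_not_injective_le (α := Fin (t + 1)) (β := Fin n)
        (by rwa [Fintype.card_fin])
      rw [Set.ncard_eq_toFinset_card', Set.toFinset_ofPred, Fintype.card_fin, Fintype.card_fin] at hni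
      have hsmall : ((t : ℝ) + 1) ^ 2 / n < c ^ (t + 1) / 2 := by
        have h1 : 2 * ((t : ℝ) + 1) ^ 2 / c ^ (t + 1) < n := hM.trans_le (by exact_mod_cast hnM)
        rw [div_lt_iff₀ (by positivity)] at h1
        rw [div_lt_iff₀ hn0]
        linarith
      have hnk : (0 : ℝ) < (n : ℝ) ^ k := by positivity
      have hnt : (0 : ℝ) < (n : ℝ) ^ (t + 1) := by positivity
      have h3 := mul_le_mul_of_nonneg_right hni hnk.le
      have h4 := mul_lt_mul_of_pos_right hsmall (mul_pos hnt hnk)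
      rw [pow_add (n : ℝ)] at hpow
      push_cast at hsum h3
      nlinarith
    obtain ⟨a, ha, has⟩ := hN n hnN (G τ) hcard
    refine ⟨Fin.cons τ a, fun i => ?_, fun s => ?_⟩
    · refine Fin.cases ?_ (fun i => ?_) i
      · simpa using hτ
      · simpa using ha i
    · have h := has fun i => s i.succ
      simp only [G, F, mem_filter, mem_univ, true_and] at h
      convert h (s 0) using 1
      funext i
      refine Fin.cases ?_ (fun i => ?_) i <;> simp

/-- Chernoff-type count of the maps `f` for which few `f k` are joined to the pair `(f i, f j)`. -/
theorem card_low_codegree_le {ι V : Type*} [Fintype ι] [DecidableEq ι] [Fintype V]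
    (T : V → V → V → Prop) {p s : ℝ} (hs0 : 0 ≤ s) (hs1 : s ≤ 1) (hsp : s * p ≤ 1)
    (hT : ∀ a b, a ≠ b → p * Fintype.card V ≤ {c | T a b c}.ncard)
    {i j : ι} (hij : i ≠ j) (r : ℕ) :
    (1 - s) ^ r * ({f : ι → V | f i ≠ f j ∧ {k | T (f i) (f j) (f k)}.ncard ≤ r}.ncard : ℝ) ≤
      (Fintype.card V : ℝ) ^ 2 *
        ((1 - s * p) * Fintype.card V) ^ (Fintype.card ι - 2) := by
  classical
  let w : V → V → ι → V → ℝ := fun a b k v =>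
    if k = i then (if v = a then 1 else 0) else if k = j then (if v = b then 1 else 0)
    else if T a b v then 1 - s else 1
  have w_nonneg : ∀ a b k v, 0 ≤ w a b k v := by
    intro a b k v
    simp only [w]
    split_ifs <;> linarith
  have hsum : ∀ a b, a ≠ b → ∏ k, ∑ v, w a b k v ≤
      ((1 - s * p) * Fintype.card V) ^ (Fintype.card ι - 2) := by
    intro a b hab
    have hi : ∑ v, w a b i v = 1 := by simp [w]
    have hj : ∑ v, w a b j v = 1 := by simp [w, hij.symm]
    rw [← mul_prod_erase _ _ (mem_univ i), hi, one_mul,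
      ← mul_prod_erase _ _ (mem_erase.2 ⟨hij.symm, mem_univ j⟩), hj, one_mul]
    have hcard : #((univ.erase i).erase j) = Fintype.card ι - 2 := by
      rw [card_erase_of_mem (mem_erase.2 ⟨hij.symm, mem_univ j⟩), card_erase_of_mem (mem_univ i),
        card_univ, Nat.sub_sub]
    rw [← hcard]
    refine (prod_le_prod (fun k _ => sum_nonneg fun v _ => w_nonneg a b k v) fun k hk => ?_).trans_eq
      (prod_const _)
    have hki : k ≠ i := by simp at hk; exact hk.2
    have hkj : k ≠ j := by simp at hk; exact hk.1
    have hw : ∀ v, w a b k v = 1 - s * if T a b v then 1 else 0 := by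
      intro v
      simp only [w, if_neg hki, if_neg hkj]
      split_ifs <;> ring
    simp only [hw, sum_sub_distrib, ← mul_sum, sum_boole, sum_const, card_univ, nsmul_eq_mul]
    have h := hT a b hab
    rw [Set.ncard_eq_toFinset_card', Set.toFinset_ofPred] at h
    nlinarith
  set Bad : Finset (ι → V) := {f | f i ≠ f j ∧ {k | T (f i) (f j) (f k)}.ncard ≤ r} with hBad
  have hle : ∀ f ∈ Bad, (1 - s) ^ r ≤
      ∑ q ∈ ({q | q.1 ≠ q.2} : Finset (V × V)), ∏ k, w q.1 q.2 k (f k) := by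
    intro f hf
    simp only [Bad, mem_filter, mem_univ, true_and] at hf
    obtain ⟨hne, hr⟩ := hf
    refine le_trans ?_ (single_le_sum (f := fun q : V × V => ∏ k, w q.1 q.2 k (f k))
      (fun q _ => prod_nonneg fun k _ => w_nonneg q.1 q.2 k (f k))
      (a := (f i, f j)) (by simpa using hne))
    rw [Set.ncard_eq_toFinset_card', Set.toFinset_ofPred] at hr
    calc (1 - s) ^ r ≤ (1 - s) ^ #{k | T (f i) (f j) (f k)} :=
          pow_le_pow_of_le_one (by linarith) (by linarith) hr
      _ = ∏ k, if T (f i) (f j) (f k) then 1 - s else 1 := by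
          rw [prod_ite, prod_const, prod_const_one, mul_one]
      _ ≤ ∏ k, w (f i) (f j) k (f k) := by
          refine prod_le_prod (fun k _ => by split_ifs <;> linarith) fun k _ => ?_
          simp only [w]
          by_cases hki : k = i
          · subst hki; simp; split_ifs <;> linarith
          · by_cases hkj : k = j
            · subst hkj; simp [hki]; split_ifs <;> linarith
            · simp [hki, hkj]
  rw [Set.ncard_eq_toFinset_card', Set.toFinset_ofPred, ← hBad]
  calc (1 - s) ^ r * (#Bad : ℝ) = ∑ f ∈ Bad, (1 - s) ^ r := by
        rw [sum_const, nsmul_eq_mul, mul_comm]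
    _ ≤ ∑ f ∈ Bad, ∑ q ∈ ({q | q.1 ≠ q.2} : Finset (V × V)), ∏ k, w q.1 q.2 k (f k) :=
        sum_le_sum hle
    _ ≤ ∑ f : ι → V, ∑ q ∈ ({q | q.1 ≠ q.2} : Finset (V × V)), ∏ k, w q.1 q.2 k (f k) :=
        sum_le_sum_of_subset_of_nonneg (subset_univ _) fun f _ _ =>
          sum_nonneg fun q _ => prod_nonneg fun k _ => w_nonneg q.1 q.2 k (f k)
    _ = ∑ q ∈ ({q | q.1 ≠ q.2} : Finset (V × V)), ∏ k, ∑ v, w q.1 q.2 k v := by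
        rw [sum_comm]
        refine sum_congr rfl fun q _ => ?_
        rw [prod_univ_sum, Fintype.piFinset_univ]
    _ ≤ ∑ q ∈ ({q | q.1 ≠ q.2} : Finset (V × V)),
          ((1 - s * p) * Fintype.card V) ^ (Fintype.card ι - 2) :=
        sum_le_sum fun q hq => hsum q.1 q.2 (by simpa using hq)
    _ ≤ _ := by
        rw [sum_const, nsmul_eq_mul]
        have hnn : 0 ≤ (1 - s * p) * (Fintype.card V : ℝ) :=
          mul_nonneg (by linarith) (Nat.cast_nonneg _)
        refine mul_le_mul_of_nonneg_right ?_ (pow_nonneg hnn _)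
        have : #({q | q.1 ≠ q.2} : Finset (V × V)) ≤ Fintype.card V ^ 2 :=
          (card_le_univ _).trans (by rw [Fintype.card_prod, sq])
        exact_mod_cast this

/-- If every pair has codegree at least `(1 / 3 + ε) * n`, then for some `r` at least half of the
maps `Fin (3 * r) → Fin n` are injective and pull `T` back to a relation all of whose pairs have
codegree more than a third of the number of vertices. -/
theorem exists_sample_size {ε : ℝ} (hε : 0 < ε) : ∃ r : ℕ, 0 < r ∧ ∃ N : ℕ, ∀ n : ℕ, N ≤ n →
    ∀ T : Fin n → Fin n → Fin n → Prop,
      (∀ a b, a ≠ b → (1 / 3 + ε) * n ≤ {c | T a b c}.ncard) →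
      (1 / 2 : ℝ) * (n : ℝ) ^ (3 * r) ≤
        {f : Fin (3 * r) → Fin n | Function.Injective f ∧
          ∀ i j, i ≠ j → 3 * r < 3 * {k | T (f i) (f j) (f k)}.ncard}.ncard := by
  classical
  wlog hε1 : ε ≤ 1 / 2 generalizing ε
  · obtain ⟨r, hr, N, hN⟩ := this (ε := 1 / 2) (by norm_num) le_rfl
    refine ⟨r, hr, N, fun n hn T hT => hN n hn T fun a b hab => le_trans ?_ (hT a b hab)⟩
    gcongr
    linarith
  let s := ε / 2
  let p := 1 / 3 + ε
  let q := 1 - s * p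
  have hs0 : 0 < s := by simp only [s]; linarith
  have hs1 : s < 1 := by simp only [s]; linarith
  have hp0 : 0 < p := by simp only [p]; linarith
  have hp1 : p ≤ 1 := by simp only [p]; linarith
  have hsp : s * p < 1 := by nlinarith
  have hq0 : 0 < q := by simp only [q]; linarith
  have hρ : q ^ 3 / (1 - s) < 1 := by
    rw [div_lt_one (by linarith)]
    have h1 : q ^ 3 = 1 - s - 3 * s * ε + 3 * (s * p) ^ 2 - (s * p) ^ 3 := by
      simp only [q, p]; ring
    have h2 : (s * p) ^ 2 ≤ s ^ 2 := by
      rw [mul_pow]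
      exact mul_le_of_le_one_right (by positivity) (pow_le_one₀ hp0.le hp1)
    have h3 : 0 < (s * p) ^ 3 := by positivity
    have h4 : s ^ 2 = s * ε / 2 := by simp only [s]; ring
    have h5 : 0 < s * ε := by positivity
    linarith
  have hlim := tendsto_pow_const_mul_const_pow_of_abs_lt_one 2
    (r := q ^ 3 / (1 - s)) (by rw [abs_of_nonneg (div_nonneg (by positivity) (by linarith))]; exact hρ)
  obtain ⟨r, hr, hr0⟩ := ((hlim.eventually_lt_const (u := q ^ 2 / 36) (by positivity)).and
    (Filter.eventually_gt_atTop 0)).exists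
  obtain ⟨N, hN⟩ := exists_nat_gt (4 * ((3 * r : ℕ) : ℝ) ^ 2)
  refine ⟨r, hr0, N, fun n hn T hT => ?_⟩
  have hnN : 4 * ((3 * r : ℕ) : ℝ) ^ 2 < n := hN.trans_le (by exact_mod_cast hn)
  have hn0 : (0 : ℝ) < n := lt_of_le_of_lt (by positivity) hnN
  let Bad : Fin (3 * r) × Fin (3 * r) → Finset (Fin (3 * r) → Fin n) := fun e =>
    {f | f e.1 ≠ f e.2 ∧ {k | T (f e.1) (f e.2) (f k)}.ncard ≤ r}
  have hBad : ∀ e ∈ (univ.offDiag : Finset (Fin (3 * r) × Fin (3 * r))),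
      (#(Bad e) : ℝ) ≤ 1 / (36 * (r : ℝ) ^ 2) * (n : ℝ) ^ (3 * r) := by
    intro e he
    have h := card_low_codegree_le (ι := Fin (3 * r)) T (p := p) hs0.le hs1.le hsp.le
      (by simpa [p] using hT) (mem_offDiag.1 he).2.2 r
    rw [Set.ncard_eq_toFinset_card', Set.toFinset_ofPred, Fintype.card_fin, Fintype.card_fin] at h
    have hsr : 0 < (1 - s) ^ r := pow_pos (by linarith) r
    rw [div_pow, ← pow_mul, mul_div_assoc', div_lt_iff₀ hsr] at hr
    obtain ⟨m, hm⟩ : ∃ m, 3 * r = m + 2 := ⟨3 * r - 2, by omega⟩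
    have hr' : 0 < (r : ℝ) := by exact_mod_cast hr0
    have e1 : (n : ℝ) ^ 2 * (q * n) ^ (3 * r - 2) * q ^ 2 = q ^ (3 * r) * n ^ (3 * r) := by
      rw [hm, Nat.add_sub_cancel, mul_pow, pow_add, pow_add]
      ring
    have e2 : q ^ (3 * r) ≤ 1 / (36 * (r : ℝ) ^ 2) * (q ^ 2 * (1 - s) ^ r) := by
      rw [one_div, inv_mul_eq_div, le_div_iff₀ (by positivity)]
      linarith
    refine le_of_mul_le_mul_left (a := (1 - s) ^ r * q ^ 2) ?_ (by positivity)
    calc (1 - s) ^ r * q ^ 2 * (#(Bad e) : ℝ) = (1 - s) ^ r * (#(Bad e) : ℝ) * q ^ 2 := by ring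
      _ ≤ (n : ℝ) ^ 2 * (q * n) ^ (3 * r - 2) * q ^ 2 := by gcongr
      _ = q ^ (3 * r) * n ^ (3 * r) := e1
      _ ≤ 1 / (36 * (r : ℝ) ^ 2) * (q ^ 2 * (1 - s) ^ r) * n ^ (3 * r) := by gcongr
      _ = _ := by ring
  have hsumBad : ∑ e ∈ (univ.offDiag : Finset (Fin (3 * r) × Fin (3 * r))), (#(Bad e) : ℝ) ≤
      1 / 4 * (n : ℝ) ^ (3 * r) := by
    have hr' : 0 < (r : ℝ) := by exact_mod_cast hr0
    have hcard : (#(univ.offDiag : Finset (Fin (3 * r) × Fin (3 * r))) : ℝ) ≤ 9 * (r : ℝ) ^ 2 := by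
      have : #(univ.offDiag : Finset (Fin (3 * r) × Fin (3 * r))) ≤ 9 * r ^ 2 :=
        (card_le_univ _).trans_eq (by rw [Fintype.card_prod, Fintype.card_fin]; ring)
      exact_mod_cast this
    refine (sum_le_sum hBad).trans ?_
    rw [sum_const, nsmul_eq_mul]
    calc _ ≤ 9 * (r : ℝ) ^ 2 * (1 / (36 * (r : ℝ) ^ 2) * (n : ℝ) ^ (3 * r)) := by gcongr
      _ = _ := by field_simp; norm_num
  have hni := card_not_injective_le (α := Fin (3 * r)) (β := Fin n)
    (by simpa using (by exact_mod_cast hn0 : 0 < n))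
  rw [Set.ncard_eq_toFinset_card', Set.toFinset_ofPred, Fintype.card_fin, Fintype.card_fin] at hni
  have hsmall : ((3 * r : ℕ) : ℝ) ^ 2 / n ≤ 1 / 4 := by
    rw [div_le_iff₀ hn0]
    linarith
  have hni' := hni.trans (mul_le_mul_of_nonneg_right hsmall (by positivity))
  rw [Set.ncard_eq_toFinset_card', Set.toFinset_ofPred]
  set Good : Finset (Fin (3 * r) → Fin n) := {f | Function.Injective f ∧
    ∀ i j, i ≠ j → 3 * r < 3 * {k | T (f i) (f j) (f k)}.ncard}
  have hcover : (univ : Finset (Fin (3 * r) → Fin n)) ⊆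
      Good ∪ (({f | ¬ Function.Injective f} : Finset (Fin (3 * r) → Fin n)) ∪
        univ.offDiag.biUnion Bad) := by
    intro f _
    by_cases hf : Function.Injective f
    · by_cases hg : ∀ i j, i ≠ j → 3 * r < 3 * {k | T (f i) (f j) (f k)}.ncard
      · exact mem_union_left _ (mem_filter.2 ⟨mem_univ _, hf, hg⟩)
      · push Not at hg
        obtain ⟨i, j, hij, hle⟩ := hg
        refine mem_union_right _ (mem_union_right _ (mem_biUnion.2 ⟨(i, j), by simpa using hij, ?_⟩))
        simp only [Bad, mem_filter, mem_univ, true_and]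
        exact ⟨hf.ne hij, by omega⟩
    · simp [hf]
  have hcount := (card_le_card hcover).trans ((card_union_le _ _).trans
    (Nat.add_le_add_left ((card_union_le _ _).trans (Nat.add_le_add_left card_biUnion_le _)) _))
  rw [card_univ, Fintype.card_fun, Fintype.card_fin, Fintype.card_fin] at hcount
  have hcount' : (n : ℝ) ^ (3 * r) ≤ #Good +
      (#({f | ¬ Function.Injective f} : Finset (Fin (3 * r) → Fin n)) +
        ∑ e ∈ (univ.offDiag : Finset (Fin (3 * r) × Fin (3 * r))), (#(Bad e) : ℝ)) := by
    exact_mod_cast hcount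
  linarith

theorem exists_hasTightCycle_eleven {ε : ℝ} (hε : 0 < ε) : ∃ N : ℕ, ∀ n : ℕ, N ≤ n →
    ∀ H : Finset (Finset (Fin n)), IsUniform3 H →
      (∀ a b, a ≠ b → (1 / 3 + ε) * n ≤ codeg H a b) → HasTightCycle 11 H := by
  classical
  obtain ⟨r, hr, N₁, hN₁⟩ := exists_sample_size hε
  obtain ⟨N₂, hN₂⟩ := exists_complete_partite 10 (3 * r)
    (1 / 2 / Fintype.card (ZMod 11 → Fin (3 * r))) (by
      have : Nonempty (Fin (3 * r)) := ⟨⟨0, by omega⟩⟩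
      have : 0 < Fintype.card (ZMod 11 → Fin (3 * r)) := Fintype.card_pos
      positivity)
  refine ⟨max N₁ N₂, fun n hn H hH hcodeg => ?_⟩
  let T : Fin n → Fin n → Fin n → Prop := fun a b c => ({a, b, c} : Finset (Fin n)) ∈ H
  have swap : ∀ {a b c}, T a b c → T b a c := by
    intro a b c h
    simp only [T] at h ⊢
    rwa [insert_comm]
  have rot : ∀ {a b c}, T a b c → T b c a := by
    intro a b c h
    simp only [T] at h ⊢
    convert h using 1
    ext z
    simp only [mem_insert, mem_singleton]
    tauto
  have irr : ∀ {a b c}, T a b c → a ≠ b := by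
    rintro a b c h rfl
    have h3 := hH _ h
    rw [insert_idem] at h3
    have := card_le_two (a := a) (b := c)
    omega
  have hgood := hN₁ n ((le_max_left _ _).trans hn) T hcodeg
  rw [Set.ncard_eq_toFinset_card', Set.toFinset_ofPred] at hgood
  set Good : Finset (Fin (3 * r) → Fin n) := {f | Function.Injective f ∧
    ∀ i j, i ≠ j → 3 * r < 3 * {k | T (f i) (f j) (f k)}.ncard}
  let S : (ZMod 11 → Fin (3 * r)) → Finset (Fin (3 * r) → Fin n) := fun x =>
    {f | Function.Injective f ∧ ∀ i, T (f (x (i - 1))) (f (x i)) (f (x (i + 1)))}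
  have hcover : Good ⊆ univ.biUnion S := by
    intro f hf
    obtain ⟨hinj, hdeg⟩ := (mem_filter.1 hf).2
    obtain ⟨x, hx⟩ := exists_closed_tight_walk (fun i j k => T (f i) (f j) (f k))
      (fun h => swap h) (fun h => rot h) (fun h h' => irr h (congrArg f h'))
      (by simpa using hdeg) (by simp; omega)
    exact mem_biUnion.2 ⟨x, mem_univ _, by simp [S, hinj, hx]⟩
  obtain ⟨x, hx⟩ : ∃ x, 1 / 2 / (Fintype.card (ZMod 11 → Fin (3 * r)) : ℝ) * (n : ℝ) ^ (3 * r) ≤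
      #(S x) := by
    have hne : (univ : Finset (ZMod 11 → Fin (3 * r))).Nonempty := ⟨fun _ => ⟨0, by omega⟩, mem_univ _⟩
    have hcard : (0 : ℝ) < Fintype.card (ZMod 11 → Fin (3 * r)) := by
      exact_mod_cast card_pos.2 hne
    obtain ⟨x, -, hx⟩ := exists_le_of_sum_le (s := univ)
      (f := fun _ : ZMod 11 → Fin (3 * r) =>
        1 / 2 / (Fintype.card (ZMod 11 → Fin (3 * r)) : ℝ) * (n : ℝ) ^ (3 * r))
      (g := fun x => (#(S x) : ℝ)) hne (by
        rw [sum_const, nsmul_eq_mul, card_univ]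
        have : (#Good : ℝ) ≤ ∑ x, (#(S x) : ℝ) := by
          exact_mod_cast (card_le_card hcover).trans card_biUnion_le
        refine le_trans (le_of_eq ?_) (hgood.trans this)
        field_simp)
    exact ⟨x, hx⟩
  obtain ⟨a, ha, has⟩ := hN₂ n ((le_max_right _ _).trans hn) (S x) hx
  have hS : ∀ s : Fin (3 * r) → ZMod 11, Function.Injective (fun l => a l (s l)) ∧
      ∀ i, T (a (x (i - 1)) (s (x (i - 1)))) (a (x i) (s (x i))) (a (x (i + 1)) (s (x (i + 1)))) :=
    fun s => (mem_filter.1 (has s)).2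
  have hx_ne : ∀ i, x (i - 1) ≠ x i ∧ x i ≠ x (i + 1) ∧ x (i - 1) ≠ x (i + 1) := by
    intro i
    have h := (hS fun _ => 0).2 i
    refine ⟨fun h' => irr h ?_, fun h' => irr (rot h) ?_, fun h' => irr (rot (rot h)) ?_⟩ <;> rw [h']
  refine ⟨fun i => a (x i) i, fun i j hij => ?_, fun i => ?_⟩
  · by_cases hxij : x i = x j
    · simp only [hxij] at hij
      exact ha _ hij
    · refine absurd ((hS fun l => if l = x i then i else j).1 (a₁ := x i) (a₂ := x j) ?_) hxij
      simpa [Ne.symm hxij] using hij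
  · obtain ⟨h1, h2, h3⟩ := hx_ne i
    have h := (hS fun l => if l = x (i - 1) then i - 1 else if l = x i then i else i + 1).2 i
    simpa [T, h1.symm, h2.symm, h3.symm] using h

theorem codeg_le {n : ℕ} (H : Finset (Finset (Fin n))) (u v : Fin n) : codeg H u v ≤ n :=
  (Set.ncard_le_card _).trans_eq (by simp)

theorem minCodeg_le_codeg {n : ℕ} (H : Finset (Finset (Fin n))) {u v : Fin n} (h : u ≠ v) :
    minCodeg H ≤ codeg H u v :=
  Nat.sInf_le ⟨u, v, h, rfl⟩

theorem bddAbove_minCodeg {ℓ n : ℕ} (hn : 2 ≤ n) : BddAbove {k : ℕ | ∃ H : Finset (Finset (Fin n)),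
    IsUniform3 H ∧ ¬ HasTightCycle ℓ H ∧ minCodeg H = k} := by
  refine ⟨n, ?_⟩
  rintro k ⟨H, -, -, rfl⟩
  exact (minCodeg_le_codeg H (u := ⟨0, by omega⟩) (v := ⟨1, by omega⟩) (by simp)).trans
    (codeg_le H _ _)

theorem card_residue_class (n : ℕ) (c : ZMod 3) :
    n ≤ 3 * #({w : Fin n | ((w : ℕ) : ZMod 3) = c} : Finset (Fin n)) + 2 := by
  have h : n / 3 ≤ #({w : Fin n | ((w : ℕ) : ZMod 3) = c} : Finset (Fin n)) := by
    have hc := c.val_lt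
    rw [← card_fin (n / 3)]
    refine card_le_card_of_injOn (fun j => ⟨3 * j + c.val, by have := j.2; omega⟩) ?_ ?_
    · intro j _
      have h3 : (3 : ZMod 3) = 0 := rfl
      simp [h3]
    · intro i _ j _ h
      simp only [Fin.mk.injEq] at h
      exact Fin.ext (by omega)
  omega

theorem le_exCodeg_eleven {n : ℕ} (hn : 2 ≤ n) : n ≤ 3 * exCodeg 11 n + 8 := by
  classical
  let φ : Fin n → ZMod 3 := fun w => ((w : ℕ) : ZMod 3)
  let H : Finset (Finset (Fin n)) := {e | #e = 3 ∧ ∑ w ∈ e, φ w = 1}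
  have hH : IsUniform3 H := fun e he => (mem_filter.1 he).2.1
  have hfree : ¬ HasTightCycle 11 H := by
    rintro ⟨x, hx, hedge⟩
    have h10 : (1 : ZMod 11) ≠ 0 := by decide
    have hsum : ∀ i, φ (x (i - 1)) + φ (x i) + φ (x (i + 1)) = 1 := by
      intro i
      have h1 : x (i - 1) ≠ x i := hx.ne (by simp [h10])
      have h2 : x i ≠ x (i + 1) := hx.ne (by simp [h10])
      have h3 : x (i - 1) ≠ x (i + 1) := hx.ne fun h => by
        have : (2 : ZMod 11) = 0 := by linear_combination -h
        exact absurd this (by decide)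
      have h := (mem_filter.1 (hedge i)).2.2
      rw [sum_insert (by simp [h1, h3]), sum_insert (by simp [h2]), sum_singleton] at h
      rw [← h]
      ring
    have hper : ∀ i, φ (x (i + 3)) = φ (x i) := by
      intro i
      have e1 := hsum (i + 1)
      have e2 := hsum (i + 2)
      rw [show i + 1 - 1 = i by ring, show i + 1 + 1 = i + 2 by ring] at e1
      rw [show i + 2 - 1 = i + 1 by ring, show i + 2 + 1 = i + 3 by ring] at e2
      linear_combination e2 - e1
    have hone : ∀ i, φ (x (i + 1)) = φ (x i) := by
      intro i
      have h12 : (12 : ZMod 11) = 1 := rfl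
      have h : i + 1 = i + 3 + 3 + 3 + 3 := by linear_combination -h12
      rw [h, hper, hper, hper, hper]
    have e := hsum 0
    have e1 := hone (-1)
    have e2 := hone 0
    simp only [zero_sub, neg_add_cancel, zero_add] at e e1 e2
    have h3 : (3 : ZMod 3) = 0 := rfl
    rw [e2, ← e1] at e
    have : (0 : ZMod 3) = 1 := by linear_combination e - φ (x 0) * h3
    exact absurd this (by decide)
  have hdeg : ∀ u v : Fin n, u ≠ v → n ≤ 3 * codeg H u v + 8 := by
    intro u v huv
    have h := card_residue_class n (1 - φ u - φ v)
    have hsub : (({w : Fin n | ((w : ℕ) : ZMod 3) = 1 - φ u - φ v} : Finset (Fin n)) \ {u, v} :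
        Finset (Fin n)) ⊆ ({w : Fin n | ({u, v, w} : Finset (Fin n)) ∈ H} : Finset (Fin n)) := by
      intro w hw
      simp only [mem_sdiff, mem_filter, mem_univ, true_and, mem_insert, mem_singleton, not_or] at hw
      obtain ⟨hw, hwu, hwv⟩ := hw
      simp only [H, mem_filter, mem_univ, true_and]
      refine ⟨card_eq_three.2 ⟨u, v, w, huv, Ne.symm hwu, Ne.symm hwv, rfl⟩, ?_⟩
      rw [sum_insert (by simp [huv, Ne.symm hwu]), sum_insert (by simp [Ne.symm hwv]), sum_singleton]
      have hw : φ w = 1 - φ u - φ v := hw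
      rw [hw]
      ring
    have h1 := card_le_card hsub
    have h2 := le_card_sdiff {u, v} ({w : Fin n | ((w : ℕ) : ZMod 3) = 1 - φ u - φ v} : Finset (Fin n))
    have h3 := card_le_two (a := u) (b := v)
    rw [codeg, Set.ncard_eq_toFinset_card', Set.toFinset_ofPred]
    omega
  have hmin : n ≤ 3 * minCodeg H + 8 := by
    obtain ⟨u, v, huv, h⟩ := Nat.sInf_mem (s := {d : ℕ | ∃ u v : Fin n, u ≠ v ∧ codeg H u v = d})
      ⟨_, ⟨0, by omega⟩, ⟨1, by omega⟩, by simp, rfl⟩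
    have := hdeg u v huv
    rw [minCodeg, ← h]
    exact this
  have : minCodeg H ≤ exCodeg 11 n := le_csSup (bddAbove_minCodeg hn) ⟨H, hH, hfree, rfl⟩
  omega

theorem exCodeg_eleven_lt {ε : ℝ} (hε : 0 < ε) : ∃ N : ℕ, ∀ n : ℕ, N ≤ n →
    (exCodeg 11 n : ℝ) < (1 / 3 + ε) * n := by
  obtain ⟨N, hN⟩ := exists_hasTightCycle_eleven hε
  refine ⟨max N 2, fun n hn => ?_⟩
  have hn2 : 2 ≤ n := (le_max_right _ _).trans hn
  have hempty : ¬ HasTightCycle 11 (∅ : Finset (Finset (Fin n))) := by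
    rintro ⟨x, -, hx⟩
    simpa using hx 0
  obtain ⟨H, hH, hfree, hk⟩ := Nat.sSup_mem
    (s := {k : ℕ | ∃ H : Finset (Finset (Fin n)), IsUniform3 H ∧ ¬ HasTightCycle 11 H ∧ minCodeg H = k})
    ⟨_, ∅, by simp [IsUniform3], hempty, rfl⟩ (bddAbove_minCodeg hn2)
  by_contra! hle
  refine hfree (hN n ((le_max_left _ _).trans hn) H hH fun a b hab => hle.trans ?_)
  rw [exCodeg, ← hk]
  exact_mod_cast minCodeg_le_codeg H hab

/-- The codegree Turán density of the tight cycle `C₁₁` equals `1/3`. -/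
theorem codegree_turan_density_C11 :
    Filter.Tendsto (fun n : ℕ => (exCodeg 11 n : ℝ) / n) Filter.atTop (nhds (1 / 3)) := by
  rw [Metric.tendsto_atTop]
  intro ε hε
  obtain ⟨N, hN⟩ := exCodeg_eleven_lt hε
  obtain ⟨M, hM⟩ := exists_nat_gt (8 / (3 * ε))
  refine ⟨max N (max M 2), fun n hn => ?_⟩
  have hn2 : 2 ≤ n := (le_max_right _ _).trans ((le_max_right _ _).trans hn)
  have hnM : M ≤ n := (le_max_left _ _).trans ((le_max_right _ _).trans hn)
  have hn0 : (0 : ℝ) < n := by exact_mod_cast (by omega : 0 < n)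
  have hupper := hN n ((le_max_left _ _).trans hn)
  have hlower : (n : ℝ) ≤ 3 * exCodeg 11 n + 8 := by exact_mod_cast le_exCodeg_eleven hn2
  have hMn : 8 / (3 * ε) < n := hM.trans_le (by exact_mod_cast hnM)
  rw [div_lt_iff₀ (by positivity)] at hMn
  rw [Real.dist_eq, abs_sub_lt_iff, sub_lt_iff_lt_add, sub_lt_comm, div_lt_iff₀ hn0,
    lt_div_iff₀ hn0]
  constructor <;> nlinarith
end

section
/- The sequence ex₂(n, C₁₇)/n converges to 1/3 as n → ∞; that is, the codegree Turán density of the 3-uniform tight cycle C₁₇ equals 1/3. -/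
open Finset

namespace TightCycle

section Core

variable {V : Type*} {E : V → V → V → Prop}

/-- `x` is the apex of a copy of `K₄⁻` one of whose edges is `xyz`. -/
def Apex (E : V → V → V → Prop) (x y z : V) : Prop :=
  E x y z ∧ ∃ u, E x y u ∧ E x z u

/-- A closed tight walk of length `17` in the ternary relation `E`. -/
def HasClosedWalk17 (E : V → V → V → Prop) : Prop :=
  ∃ w : ZMod 17 → V, ∀ i, E (w (i - 1)) (w i) (w (i + 1))

lemma Apex.swap (h₂ : ∀ x y z, E x y z → E x z y) {x y z : V} (h : Apex E x y z) :
    Apex E x z y := by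
  obtain ⟨e, u, e₁, e₂⟩ := h
  exact ⟨h₂ _ _ _ e, u, e₂, e₁⟩

/-- If a pair is oriented in both ways by apices, then there is a closed walk of length `17`. -/
lemma hasClosedWalk17_of_apex_of_apex (h₁ : ∀ x y z, E x y z → E y x z)
    (h₂ : ∀ x y z, E x y z → E x z y) {x y z w : V}
    (hx : Apex E x y z) (hy : Apex E y x w) : HasClosedWalk17 E := by
  obtain ⟨e, u, e₁, e₂⟩ := hx
  obtain ⟨f, v, f₁, f₂⟩ := hy
  refine ⟨![x, y, w, x, y, w, x, y, w, v, y, x, z, y, x, z, u], fun i => ?_⟩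
  fin_cases i <;> solve_by_elim (maxDepth := 6) only [h₁, h₂, e, e₁, e₂, f, f₁, f₂]

/-- If a pair is both opposite to an apex and oriented by an apex, then there is a closed walk of
length `17`. -/
lemma hasClosedWalk17_of_apex_of_base (h₁ : ∀ x y z, E x y z → E y x z)
    (h₂ : ∀ x y z, E x y z → E x z y) {x y z w : V}
    (hx : Apex E x y z) (hy : Apex E y z w) : HasClosedWalk17 E := by
  obtain ⟨e, u, e₁, e₂⟩ := hx
  obtain ⟨f, v, f₁, f₂⟩ := hy
  refine ⟨![x, y, z, w, y, z, v, y, w, z, y, x, z, y, x, z, u], fun i => ?_⟩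
  fin_cases i <;> solve_by_elim (maxDepth := 6) only [h₁, h₂, e, e₁, e₂, f, f₁, f₂]

/-- Two of three sets of total size larger than the ground set intersect. -/
lemma exists_mem_two_of_card_lt [Fintype V] [DecidableEq V] (A B C : Finset V)
    (h : Fintype.card V < #A + #B + #C) :
    ∃ u, u ∈ A ∧ u ∈ B ∨ u ∈ A ∧ u ∈ C ∨ u ∈ B ∧ u ∈ C := by
  by_contra! hne
  have hAB : Disjoint A B := Finset.disjoint_left.2 fun u ha hb => (hne u).1 ha hb
  have hABC : Disjoint (A ∪ B) C := Finset.disjoint_left.2 fun u hab hc => by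
    rcases Finset.mem_union.1 hab with ha | hb
    · exact (hne u).2.1 ha hc
    · exact (hne u).2.2 hb hc
  have := Finset.card_le_univ (A ∪ B ∪ C)
  rw [Finset.card_union_of_disjoint hABC, Finset.card_union_of_disjoint hAB] at this
  omega

open Classical in
/-- A symmetric irreflexive ternary relation in which all codegrees exceed a third of the number
of vertices has a closed tight walk of length `17`. -/
theorem hasClosedWalk17_of_card_lt [Fintype V] [Nontrivial V]
    (h₁ : ∀ x y z, E x y z → E y x z) (h₂ : ∀ x y z, E x y z → E x z y)
    (hne : ∀ x y z, E x y z → x ≠ y)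
    (hE : ∀ x y, x ≠ y → Fintype.card V < 3 * #{z | E x y z}) : HasClosedWalk17 E := by
  by_contra hno
  have no₁ : ∀ {x y z w}, Apex E x y z → ¬ Apex E y x w := fun hx hy =>
    hno (hasClosedWalk17_of_apex_of_apex h₁ h₂ hx hy)
  have no₂ : ∀ {x y z w}, Apex E x y z → ¬ Apex E y z w := fun hx hy =>
    hno (hasClosedWalk17_of_apex_of_base h₁ h₂ hx hy)
  have sw : ∀ {x y z}, Apex E x y z → Apex E x z y := fun h => h.swap h₂
  have apex : ∀ {x y z}, E x y z → Apex E x y z ∨ Apex E y x z ∨ Apex E z x y := by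
    intro x y z e
    have hxy := hE x y (hne _ _ _ e)
    have hxz := hE x z (hne _ _ _ (h₂ _ _ _ e))
    have hyz := hE y z (hne _ _ _ (h₂ _ _ _ (h₁ _ _ _ e)))
    obtain ⟨u, hu⟩ := exists_mem_two_of_card_lt
      ({u | E x y u} : Finset V) {u | E x z u} {u | E y z u} (by omega)
    simp only [Finset.mem_filter, Finset.mem_univ, true_and] at hu
    rcases hu with ⟨a, b⟩ | ⟨a, b⟩ | ⟨a, b⟩
    · exact Or.inl ⟨e, u, a, b⟩
    · exact Or.inr (Or.inl ⟨h₁ _ _ _ e, u, h₁ _ _ _ a, b⟩)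
    · exact Or.inr (Or.inr ⟨h₁ _ _ _ (h₂ _ _ _ e), u, h₁ _ _ _ a, h₁ _ _ _ b⟩)
  have ex : ∀ x y, x ≠ y → ∃ z, E x y z := by
    intro x y hxy
    obtain ⟨z, hz⟩ := Finset.card_pos.1 (show 0 < #{z | E x y z} by have := hE x y hxy; omega)
    exact ⟨z, by simpa using hz⟩
  -- The three neighbourhoods of a vertex, in the apex digraph and in the graph of base pairs.
  let In : V → Finset V := fun x => {y | ∃ z, Apex E x y z}
  let Out : V → Finset V := fun x => {y | ∃ z, Apex E y x z}
  let Bs : V → Finset V := fun x => {y | ∃ z, Apex E z x y}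
  have arc : ∀ {x y z}, Apex E x y z → Fintype.card V < 3 * #(In x) ∧
      Fintype.card V < 3 * #(Bs y) := by
    intro x y z h
    have hxy := hE x y (hne _ _ _ h.1)
    have key : ∀ w, E x y w → Apex E x y w := by
      intro w e
      rcases apex e with h' | h' | h'
      · exact h'
      · exact (no₁ h h').elim
      · exact (no₂ h' h).elim
    have k₁ : #{w | E x y w} ≤ #(In x) := Finset.card_le_card fun w hw => by
      simp only [Finset.mem_filter, Finset.mem_univ, true_and, In] at hw ⊢
      exact ⟨y, sw (key w hw)⟩
    have k₂ : #{w | E x y w} ≤ #(Bs y) := Finset.card_le_card fun w hw => by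
      simp only [Finset.mem_filter, Finset.mem_univ, true_and, Bs] at hw ⊢
      exact ⟨x, key w hw⟩
    omega
  have base : ∀ {x y z}, Apex E x y z → Fintype.card V < 3 * #(Out y) := by
    intro x y z h
    have hyz := hE y z (hne _ _ _ (h₂ _ _ _ (h₁ _ _ _ h.1)))
    have k : #{w | E y z w} ≤ #(Out y) := Finset.card_le_card fun w hw => by
      simp only [Finset.mem_filter, Finset.mem_univ, true_and, Out] at hw ⊢
      rcases apex hw with h' | h' | h'
      · exact (no₂ h h').elim
      · exact (no₂ (sw h) h').elim
      · exact ⟨z, h'⟩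
    omega
  have mixed : ∀ {x y z y' z'}, Apex E x y z → ¬ Apex E y' x z' := by
    intro x y z y' z' h h'
    obtain ⟨u, hu⟩ := exists_mem_two_of_card_lt (In x) (Bs x) (Out x)
      (by have := (arc h).1; have := (arc h').2; have := base h'; omega)
    simp only [Finset.mem_filter, Finset.mem_univ, true_and, In, Bs, Out] at hu
    rcases hu with ⟨⟨_, a⟩, ⟨_, b⟩⟩ | ⟨⟨_, a⟩, ⟨_, b⟩⟩ | ⟨⟨_, a⟩, ⟨_, b⟩⟩
    · exact no₂ b a
    · exact no₁ a b
    · exact no₂ (sw a) b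
  obtain ⟨x, y, z, h⟩ : ∃ x y z, Apex E x y z := by
    obtain ⟨a, b, hab⟩ := exists_pair_ne V
    obtain ⟨c, e⟩ := ex a b hab
    rcases apex e with h | h | h <;> exact ⟨_, _, _, h⟩
  have hcard : 3 ≤ Fintype.card V := by
    have : #({x, y, z} : Finset V) = 3 := Finset.card_eq_three.2 ⟨x, y, z, hne _ _ _ h.1,
      hne _ _ _ (h₂ _ _ _ h.1), hne _ _ _ (h₂ _ _ _ (h₁ _ _ _ h.1)), rfl⟩
    exact this ▸ Finset.card_le_univ _
  obtain ⟨x', hx', hxx'⟩ := Finset.exists_mem_ne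
    (show 1 < #(Out y) by have := base h; omega) x
  simp only [Finset.mem_filter, Finset.mem_univ, true_and, Out] at hx'
  obtain ⟨v, h'⟩ := hx'
  obtain ⟨w, e⟩ := ex x x' hxx'.symm
  rcases apex e with k | k | k
  · exact mixed h' k
  · exact mixed h k
  · exact mixed h k

end Core

section Counting

variable {V ι : Type*} [Fintype V] [Fintype ι] [DecidableEq ι]

open Classical in
/-- At most a `1 / |V|` proportion of the maps `ι → V` agree on two given indices. -/
lemma card_eq_mul_card_le {i j : ι} (hij : i ≠ j) :
    #{g : ι → V | g i = g j} * Fintype.card V ≤ Fintype.card V ^ Fintype.card ι := by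
  rw [← Fintype.card_fun, ← Finset.card_univ (α := V), ← Finset.card_product,
    ← Finset.card_univ (α := ι → V)]
  refine Finset.card_le_card_of_injOn (fun p => Function.update p.1 i p.2) (by simp) ?_
  rintro ⟨g, v⟩ hg ⟨g', v'⟩ hg' h
  simp only [Finset.coe_product, Finset.coe_filter, Finset.coe_univ, Set.mem_prod,
    Set.mem_ofPred_eq, Finset.mem_univ, true_and, Set.mem_univ, and_true] at hg hg' h
  have hv : v = v' := by simpa using congrFun h i
  have hk : ∀ k, k ≠ i → g k = g' k := fun k hk => by simpa [hk] using congrFun h k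
  refine Prod.ext (funext fun k => ?_) hv
  by_cases hki : k = i
  · subst hki
    exact hg.trans ((hk j hij.symm).trans hg'.symm)
  · exact hk k hki

open Classical in
/-- Few maps `ι → V` fail to be injective. -/
lemma card_not_injective_mul_card_le :
    #{g : ι → V | ¬ Function.Injective g} * Fintype.card V ≤
      Fintype.card ι ^ 2 * Fintype.card V ^ Fintype.card ι := by
  have hsub : ({g : ι → V | ¬ Function.Injective g} : Finset (ι → V)) ⊆
      (univ : Finset ι).offDiag.biUnion fun p => {g : ι → V | g p.1 = g p.2} := by
    intro g hg
    obtain ⟨i, j, h, hij⟩ := Function.not_injective_iff.1 (Finset.mem_filter.1 hg).2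
    simp only [Finset.mem_biUnion, Finset.mem_offDiag, Finset.mem_filter, Finset.mem_univ,
      true_and]
    exact ⟨(i, j), hij, h⟩
  calc _ ≤ (∑ p ∈ (univ : Finset ι).offDiag, #{g : ι → V | g p.1 = g p.2}) * Fintype.card V :=
        Nat.mul_le_mul_right _ ((Finset.card_le_card hsub).trans Finset.card_biUnion_le)
    _ = ∑ p ∈ (univ : Finset ι).offDiag, #{g : ι → V | g p.1 = g p.2} * Fintype.card V :=
        Finset.sum_mul _ _ _
    _ ≤ ∑ p ∈ (univ : Finset ι).offDiag, Fintype.card V ^ Fintype.card ι :=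
        Finset.sum_le_sum fun p hp => card_eq_mul_card_le (Finset.mem_offDiag.1 hp).2.2
    _ ≤ _ := by
        rw [Finset.sum_const, smul_eq_mul, Finset.offDiag_card, Finset.card_univ, sq]
        exact Nat.mul_le_mul_right _ (Nat.sub_le _ _)

/-- A large family of maps into a large set contains an injective map. -/
lemma exists_injective_of_lt_card (Q : Finset (ι → V))
    (hQ : Fintype.card ι ^ 2 * Fintype.card V ^ Fintype.card ι < #Q * Fintype.card V) :
    ∃ g ∈ Q, Function.Injective g := by
  classical
  by_contra! hno
  refine hQ.not_ge ((Nat.mul_le_mul_right _ ?_).trans card_not_injective_mul_card_le)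
  exact Finset.card_le_card fun g hg => Finset.mem_filter.2 ⟨Finset.mem_univ _, hno g hg⟩

open Classical in
/-- Lower tail bound: few maps with prescribed values at two indices hit a given set rarely. -/
lemma card_few_hits_mul_pow_le {i j : ι} (hij : i ≠ j) (a b : V) (N : Finset V) {q : ℝ}
    (hq : 0 < q) (hq₁ : q ≤ 1) (M : ℕ) :
    (#{g : ι → V | g i = a ∧ g j = b ∧ #{k | g k ∈ N} ≤ M} : ℝ) * q ^ M ≤
      (Fintype.card V - (1 - q) * #N) ^ (Fintype.card ι - 2) := by
  let φ : ι → V → ℝ := fun k v =>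
    if k = i then (if v = a then 1 else 0) else if k = j then (if v = b then 1 else 0)
    else if v ∈ N then q else 1
  have hφ₀ : ∀ k v, 0 ≤ φ k v := by
    intro k v
    simp only [φ]
    split_ifs <;> positivity
  have hsum : ∑ g : ι → V, ∏ k, φ k (g k) =
      (Fintype.card V - (1 - q) * #N) ^ (Fintype.card ι - 2) := by
    rw [← Fintype.piFinset_univ, ← Finset.prod_univ_sum,
      ← Finset.mul_prod_erase _ _ (Finset.mem_univ i),
      ← Finset.mul_prod_erase _ _ (Finset.mem_erase.2 ⟨hij.symm, Finset.mem_univ j⟩)]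
    have h₁ : ∑ v, φ i v = 1 := by simp [φ]
    have h₂ : ∑ v, φ j v = 1 := by simp [φ, hij.symm]
    have h₃ : ∀ k ∈ (univ.erase i).erase j, ∑ v, φ k v =
        Fintype.card V - (1 - q) * #N := by
      intro k hk
      simp only [Finset.mem_erase, Finset.mem_univ, and_true] at hk
      have : ∀ v, φ k v = 1 - (1 - q) * if v ∈ N then 1 else 0 := by
        intro v
        simp only [φ, if_neg hk.1, if_neg hk.2]
        split_ifs <;> ring
      simp only [this, Finset.sum_sub_distrib, ← Finset.mul_sum]
      simp
    rw [h₁, h₂, one_mul, one_mul, Finset.prod_congr rfl h₃, Finset.prod_const,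
      Finset.card_erase_of_mem (Finset.mem_erase.2 ⟨hij.symm, Finset.mem_univ j⟩),
      Finset.card_erase_of_mem (Finset.mem_univ i), Finset.card_univ, Nat.sub_sub]
  rw [← hsum, ← nsmul_eq_mul, ← Finset.sum_const]
  refine (Finset.sum_le_sum fun g hg => ?_).trans
    (Finset.sum_le_univ_sum_of_nonneg fun g => Finset.prod_nonneg fun k _ => hφ₀ k _)
  simp only [Finset.mem_filter, Finset.mem_univ, true_and] at hg
  obtain ⟨rfl, rfl, hM⟩ := hg
  calc q ^ M ≤ q ^ #{k | g k ∈ N} := pow_le_pow_of_le_one hq.le hq₁ hM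
    _ = ∏ k, if g k ∈ N then q else 1 := by
        rw [← Finset.prod_filter, Finset.prod_const]
    _ ≤ ∏ k, φ k (g k) := by
        refine Finset.prod_le_prod (fun k _ => by positivity) fun k _ => ?_
        simp only [φ]
        split_ifs <;> simp_all

/-- The number of tuples satisfying a predicate, counted according to the first entry. -/
lemma card_filter_fin_cons {m : ℕ} {α : Type*} [Fintype α] (P : (Fin (m + 1) → α) → Prop)
    [DecidablePred P] :
    #{g | P g} = ∑ x : α, #{g : Fin m → α | P (Fin.cons x g)} := by
  simp only [Finset.card_filter]
  rw [← (Fin.consEquiv fun _ : Fin (m + 1) => α).sum_comp, Fintype.sum_prod_type]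
  rfl

/-- The power mean inequality for averages over a finite type. -/
lemma average_pow_le {α : Type*} [Fintype α] [Nonempty α] (f : α → ℝ) (hf : ∀ a, 0 ≤ f a)
    (k : ℕ) : ((∑ a, f a) / Fintype.card α) ^ k ≤ (∑ a, f a ^ k) / Fintype.card α := by
  have hα : (Fintype.card α : ℝ) ≠ 0 := by simp
  have := Real.pow_arith_mean_le_arith_mean_pow univ (fun _ => (Fintype.card α : ℝ)⁻¹) f
    (by simp) (by simp [hα]) (fun a _ => hf a) k
  simpa only [← Finset.mul_sum, inv_mul_eq_div, ← Finset.sum_div] using this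

open Classical in
/-- If the `m`-tuples satisfying `P` have density `d`, then the `m × t` arrays all of whose
transversals satisfy `P` have density at least `d ^ t ^ m`. -/
lemma density_pow_le_density_blowup [Nonempty V] (t : ℕ) {m : ℕ} (P : (Fin m → V) → Prop) :
    ((#{g | P g} : ℝ) / Fintype.card V ^ m) ^ t ^ m ≤
      (#{G : Fin m → Fin t → V | ∀ σ : Fin m → Fin t, P fun i => G i (σ i)} : ℝ) /
        Fintype.card V ^ (t * m) := by
  induction m with
  | zero =>
    simp only [pow_zero, pow_one, mul_zero, div_one, Nat.cast_le]
    refine Finset.card_le_card_of_injOn (fun _ i => i.elim0) (fun g hg => ?_)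
      fun g _ g' _ _ => Subsingleton.elim _ _
    simp only [Finset.coe_filter, Finset.mem_univ, true_and, Set.mem_ofPred_eq] at hg ⊢
    intro σ
    rwa [Subsingleton.elim (fun i : Fin 0 => _) g]
  | succ m ih =>
    let deg : (Fin m → V) → ℕ := fun y => #{v | P (Fin.cons v y)}
    obtain ⟨link, hlink⟩ : ∃ link : (Fin t → V) → (Fin m → V) → Prop,
        ∀ x y, link x y ↔ ∀ s, P (Fin.cons (x s) y) := ⟨_, fun _ _ => Iff.rfl⟩
    have hP : (#{g | P g} : ℝ) = ∑ y, (deg y : ℝ) := by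
      rw [card_filter_fin_cons, ← Nat.cast_sum]
      simp only [deg, Finset.card_filter]
      rw [Finset.sum_comm]
    have hdeg : ∑ x, (#{y | link x y} : ℝ) = ∑ y, (deg y : ℝ) ^ t := by
      have : ∀ y, deg y ^ t = #{x | link x y} := by
        intro y
        rw [← Fintype.card_piFinset_const]
        congr 1
        ext x
        simp [hlink]
      simp only [← Nat.cast_pow, this, ← Nat.cast_sum, Nat.cast_inj]
      simp only [Finset.card_filter]
      rw [Finset.sum_comm]
    have hblow : #{G : Fin (m + 1) → Fin t → V | ∀ σ : Fin (m + 1) → Fin t,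
          P fun i => G i (σ i)} =
        ∑ x, #{G : Fin m → Fin t → V | ∀ σ : Fin m → Fin t, link x fun i => G i (σ i)} := by
      rw [card_filter_fin_cons]
      refine Finset.sum_congr rfl fun x _ => congrArg _ (Finset.filter_congr fun G _ => ?_)
      have hcons : ∀ (s : Fin t) (σ : Fin m → Fin t),
          (fun i => (Fin.cons x G : Fin (m + 1) → Fin t → V) i
            ((Fin.cons s σ : Fin (m + 1) → Fin t) i)) = Fin.cons (x s) fun i => G i (σ i) := by
        intro s σ
        funext i
        refine Fin.cases ?_ (fun i => ?_) i <;> simp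
      simp only [hlink]
      constructor
      · intro h σ s
        simpa only [hcons] using h (Fin.cons s σ)
      · intro h σ
        rw [← Fin.cons_self_tail σ, hcons]
        exact h _ _
    have h₁ := average_pow_le (fun y => (deg y : ℝ) / Fintype.card V) (fun y => by positivity) t
    have h₂ := average_pow_le (fun x => (#{y | link x y} : ℝ) / Fintype.card V ^ m)
      (fun x => by positivity) (t ^ m)
    have h₃ := Finset.sum_le_sum fun x (_ : x ∈ univ) => ih (link x)
    simp only [div_pow _ _ t, ← Finset.sum_div, ← hP, ← hdeg, Fintype.card_fun, Fintype.card_fin,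
      Nat.cast_pow, div_div] at h₁ h₂
    rw [hblow, Nat.cast_sum]
    calc _ = (((#{g | P g} : ℝ) / (Fintype.card V * Fintype.card V ^ m)) ^ t) ^ t ^ m := by
          rw [← pow_mul, pow_succ' t, pow_succ' (Fintype.card V : ℝ)]
      _ ≤ ((∑ x, (#{y | link x y} : ℝ)) / (Fintype.card V ^ m * Fintype.card V ^ t)) ^ t ^ m := by
          refine pow_le_pow_left₀ (by positivity) ?_ _
          rw [div_pow]
          exact h₁.trans_eq (by rw [mul_comm])
      _ ≤ _ := h₂
      _ ≤ _ := div_le_div_of_nonneg_right h₃ (by positivity)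
      _ = _ := by
          rw [← Finset.sum_div, div_div, ← pow_add, mul_add_one]

end Counting

section Sampling

open Classical in
/-- For two fixed indices, exponentially few maps hit the set attached to their values rarely. -/
lemma card_few_hits_le {V ι : Type*} [Fintype V] [Fintype ι] [DecidableEq ι] {i j : ι} (hij : i ≠ j)
    (N : V → V → Finset V) {p q : ℝ} (hq : 0 < q) (hq₁ : q ≤ 1)
    (hp : 0 ≤ 1 - (1 - q) * p)
    (hN : ∀ a b, a ≠ b → p * Fintype.card V ≤ #(N a b)) (M : ℕ) :
    (#{g : ι → V | g i ≠ g j ∧ #{k | g k ∈ N (g i) (g j)} ≤ M} : ℝ) * q ^ M *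
      (1 - (1 - q) * p) ^ 2 ≤
      Fintype.card V ^ Fintype.card ι * (1 - (1 - q) * p) ^ Fintype.card ι := by
  have hι : Fintype.card ι = Fintype.card ι - 2 + 2 := by
    have : 1 < Fintype.card ι := Fintype.one_lt_card_iff.2 ⟨i, j, hij⟩
    omega
  have hsub : ({g : ι → V | g i ≠ g j ∧ #{k | g k ∈ N (g i) (g j)} ≤ M} : Finset (ι → V)) ⊆
      (univ : Finset V).offDiag.biUnion fun p =>
        {g : ι → V | g i = p.1 ∧ g j = p.2 ∧ #{k | g k ∈ N p.1 p.2} ≤ M} := by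
    intro g hg
    obtain ⟨h₁, h₂⟩ := (Finset.mem_filter.1 hg).2
    simp only [Finset.mem_biUnion, Finset.mem_offDiag, Finset.mem_filter, Finset.mem_univ,
      true_and]
    exact ⟨(g i, g j), h₁, rfl, rfl, h₂⟩
  have hr : ∀ a b : V, a ≠ b → 0 ≤ Fintype.card V - (1 - q) * (#(N a b) : ℝ) ∧
      Fintype.card V - (1 - q) * (#(N a b) : ℝ) ≤ Fintype.card V * (1 - (1 - q) * p) := by
    intro a b hab
    have h₁ : (#(N a b) : ℝ) ≤ Fintype.card V := by exact_mod_cast Finset.card_le_univ _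
    have h₂ := mul_le_mul_of_nonneg_left (hN a b hab) (sub_nonneg.2 hq₁)
    have h₃ : 0 ≤ q * (#(N a b) : ℝ) := by positivity
    constructor <;> linarith
  have key : (#{g : ι → V | g i ≠ g j ∧ #{k | g k ∈ N (g i) (g j)} ≤ M} : ℝ) * q ^ M ≤
      Fintype.card V ^ 2 *
        (Fintype.card V * (1 - (1 - q) * p)) ^ (Fintype.card ι - 2) := by
    calc _ ≤ ((∑ p ∈ (univ : Finset V).offDiag,
            #{g : ι → V | g i = p.1 ∧ g j = p.2 ∧ #{k | g k ∈ N p.1 p.2} ≤ M} : ℕ) : ℝ) *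
            q ^ M := by
          gcongr
          exact (Finset.card_le_card hsub).trans Finset.card_biUnion_le
      _ ≤ ∑ _p ∈ (univ : Finset V).offDiag,
            (Fintype.card V * (1 - (1 - q) * p)) ^ (Fintype.card ι - 2) := by
          rw [Nat.cast_sum, Finset.sum_mul]
          refine Finset.sum_le_sum fun x hx => ?_
          have hx := hr _ _ (Finset.mem_offDiag.1 hx).2.2
          exact (card_few_hits_mul_pow_le hij _ _ _ hq hq₁ M).trans
            (pow_le_pow_left₀ hx.1 hx.2 _)
      _ ≤ _ := by
          rw [Finset.sum_const, nsmul_eq_mul]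
          refine mul_le_mul_of_nonneg_right ?_ (by positivity)
          rw [Finset.offDiag_card, Finset.card_univ, sq]
          exact_mod_cast Nat.sub_le _ _
  refine (mul_le_mul_of_nonneg_right key (sq_nonneg _)).trans_eq ?_
  generalize Fintype.card ι - 2 = l at hι
  rw [hι, mul_pow, pow_add, pow_add]
  ring

open Classical in
/-- If all the sets `N a b` with `a ≠ b` have density at least `1 / 3 + ε`, then at least half of
the samples of a suitable size hit `N a b`, for `a`, `b` sampled at any two distinct indices, in
more than a third of the indices. -/
lemma exists_sample_size {ε : ℝ} (hε : 0 < ε) (hε₁ : ε ≤ 1 / 3) :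
    ∃ M n₀ : ℕ, 0 < M ∧ ∀ (V : Type) [Fintype V] (N : V → V → Finset V),
      n₀ ≤ Fintype.card V →
      (∀ a b, a ≠ b → (1 / 3 + ε) * Fintype.card V ≤ #(N a b)) →
      ∃ S : Finset (Fin (3 * M) → V),
        (∀ g ∈ S, ∀ i j, i ≠ j → M < #{k | g k ∈ N (g i) (g j)}) ∧
        (Fintype.card V : ℝ) ^ (3 * M) ≤ 2 * #S := by
  set q : ℝ := 1 - ε / 2 with hq
  set r : ℝ := 1 - (1 - q) * (1 / 3 + ε) with hr
  have hq₀ : 0 < q := by linarith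
  have hq₁ : q ≤ 1 := by linarith
  have hr₀ : 0 < r := by rw [hr, hq]; nlinarith
  have hrq : r ^ 3 < q := by
    have : q - r ^ 3 = ε ^ 2 / 2 * (3 - 3 / 2 * (1 / 3 + ε) ^ 2) +
      (ε / 2 * (1 / 3 + ε)) ^ 3 := by rw [hr, hq]; ring
    have h₁ : (1 / 3 + ε) ^ 2 ≤ 1 := by nlinarith
    have h₂ : 0 < ε ^ 2 / 2 * (3 - 3 / 2 * (1 / 3 + ε) ^ 2) := by
      apply mul_pos <;> [positivity; linarith]
    have h₃ : 0 < (ε / 2 * (1 / 3 + ε)) ^ 3 := by positivity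
    linarith
  have hρ₀ : 0 ≤ r ^ 3 / q := by positivity
  have hρ : |r ^ 3 / q| < 1 := by rwa [abs_of_nonneg hρ₀, div_lt_one hq₀]
  have hlim := (tendsto_pow_const_mul_const_pow_of_abs_lt_one 2 hρ).eventually_le_const
    (show (0 : ℝ) < r ^ 2 / 36 by positivity)
  obtain ⟨M, hM, hM₀⟩ := (hlim.and (Filter.eventually_gt_atTop 0)).exists
  refine ⟨M, 36 * M ^ 2, hM₀, fun V _ N hV hN => ?_⟩
  set n : ℝ := (Fintype.card V : ℝ) with hn
  have hn₀ : 0 < n := by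
    have : 0 < 36 * M ^ 2 := by positivity
    rw [hn]
    exact_mod_cast this.trans_le hV
  have hbad : ∀ i j : Fin (3 * M), i ≠ j →
      (#{g : Fin (3 * M) → V | g i ≠ g j ∧ #{k | g k ∈ N (g i) (g j)} ≤ M} : ℝ) ≤
        n ^ (3 * M) * ((r ^ 3 / q) ^ M / r ^ 2) := by
    intro i j hij
    have := card_few_hits_le hij N hq₀ hq₁ hr₀.le hN M
    rw [Fintype.card_fin, ← hr, ← hn, mul_assoc, ← le_div_iff₀ (by positivity)] at this
    refine this.trans_eq ?_
    rw [div_pow, ← pow_mul]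
    field_simp
  have hinj : (#{g : Fin (3 * M) → V | ¬ Function.Injective g} : ℝ) ≤ n ^ (3 * M) / 4 := by
    have h := card_not_injective_mul_card_le (V := V) (ι := Fin (3 * M))
    rw [Fintype.card_fin] at h
    have h' : (#{g : Fin (3 * M) → V | ¬ Function.Injective g} : ℝ) * n ≤
        (3 * M) ^ 2 * n ^ (3 * M) := by rw [hn]; exact_mod_cast h
    have hV' : (36 : ℝ) * M ^ 2 ≤ n := by rw [hn]; exact_mod_cast hV
    rw [← le_div_iff₀ hn₀] at h'
    refine h'.trans ?_
    rw [div_le_iff₀ hn₀]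
    have : 0 < n ^ (3 * M) := by positivity
    nlinarith
  set S : Finset (Fin (3 * M) → V) :=
    {g | ∀ i j, i ≠ j → M < #{k | g k ∈ N (g i) (g j)}} with hS
  refine ⟨S, fun g hg => (Finset.mem_filter.1 hg).2, ?_⟩
  have hcover : (univ : Finset (Fin (3 * M) → V)) ⊆ S ∪
      (({g : Fin (3 * M) → V | ¬ Function.Injective g} : Finset _) ∪
      (univ : Finset (Fin (3 * M))).offDiag.biUnion fun p =>
        {g : Fin (3 * M) → V | g p.1 ≠ g p.2 ∧ #{k | g k ∈ N (g p.1) (g p.2)} ≤ M}) := by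
    intro g _
    simp only [hS, Finset.mem_union, Finset.mem_biUnion, Finset.mem_offDiag, Finset.mem_filter,
      Finset.mem_univ, true_and]
    by_cases hg : Function.Injective g
    · by_cases h : ∀ i j, i ≠ j → M < #{k | g k ∈ N (g i) (g j)}
      · exact Or.inl h
      · push Not at h
        obtain ⟨i, j, hij, h⟩ := h
        exact Or.inr (Or.inr ⟨(i, j), hij, hg.ne hij, h⟩)
    · exact Or.inr (Or.inl hg)
  have hcount := (Finset.card_le_card hcover).trans ((Finset.card_union_le _ _).trans
    (Nat.add_le_add_left ((Finset.card_union_le _ _).trans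
      (Nat.add_le_add_left Finset.card_biUnion_le _)) _))
  rw [Finset.card_univ, Fintype.card_fun, Fintype.card_fin] at hcount
  have hcount' : n ^ (3 * M) ≤ #S +
      ((#{g : Fin (3 * M) → V | ¬ Function.Injective g} : ℝ) +
      ∑ p ∈ (univ : Finset (Fin (3 * M))).offDiag,
        (#{g : Fin (3 * M) → V | g p.1 ≠ g p.2 ∧ #{k | g k ∈ N (g p.1) (g p.2)} ≤ M} : ℝ)) := by
    rw [hn]
    exact_mod_cast hcount
  have hsum : ∑ p ∈ (univ : Finset (Fin (3 * M))).offDiag,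
      (#{g : Fin (3 * M) → V | g p.1 ≠ g p.2 ∧ #{k | g k ∈ N (g p.1) (g p.2)} ≤ M} : ℝ) ≤
        n ^ (3 * M) / 4 := by
    refine (Finset.sum_le_sum fun p hp => hbad _ _ (Finset.mem_offDiag.1 hp).2.2).trans ?_
    rw [Finset.sum_const, nsmul_eq_mul, Finset.offDiag_card, Finset.card_univ, Fintype.card_fin]
    have h₁ : ((3 * M * (3 * M) - 3 * M : ℕ) : ℝ) ≤ 9 * (M : ℝ) ^ 2 := by
      calc _ ≤ ((3 * M * (3 * M) : ℕ) : ℝ) := by exact_mod_cast Nat.sub_le _ _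
        _ = _ := by push_cast; ring
    have h₂ : 9 * (M : ℝ) ^ 2 * ((r ^ 3 / q) ^ M / r ^ 2) ≤ 1 / 4 := by
      rw [mul_div_assoc', div_le_iff₀ (by positivity)]
      linarith
    calc _ ≤ 9 * (M : ℝ) ^ 2 * (n ^ (3 * M) * ((r ^ 3 / q) ^ M / r ^ 2)) :=
          mul_le_mul_of_nonneg_right h₁ (by positivity)
      _ = n ^ (3 * M) * (9 * (M : ℝ) ^ 2 * ((r ^ 3 / q) ^ M / r ^ 2)) := by ring
      _ ≤ n ^ (3 * M) * (1 / 4) := mul_le_mul_of_nonneg_left h₂ (by positivity)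
      _ = _ := by ring
  linarith

end Sampling

section UpperBound

open Classical in
/-- If a positive proportion of the maps `Fin m → V` send a fixed closed walk of length `17` to a
closed walk of `H`, and `V` is large, then `H` contains the tight cycle of length `17`. -/
lemma hasTightCycle_of_density {V : Type*} [Fintype V] [DecidableEq V] [Nonempty V]
    {H : Finset (Finset V)} (hH : IsUniform3 H) {m : ℕ} (w : ZMod 17 → Fin m) {c : ℝ} (hc : 0 < c)
    (hw : c ≤ (#{g : Fin m → V | ∀ i, {g (w (i - 1)), g (w i), g (w (i + 1))} ∈ H} : ℝ) /
      Fintype.card V ^ m)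
    (hV : ((m * 17 : ℕ) : ℝ) ^ 2 < c ^ 17 ^ m * Fintype.card V) : HasTightCycle 17 H := by
  have hn : (0 : ℝ) < Fintype.card V := by exact_mod_cast Fintype.card_pos
  set P : (Fin m → V) → Prop := fun g => ∀ i, {g (w (i - 1)), g (w i), g (w (i + 1))} ∈ H
  have hblow := (pow_le_pow_left₀ hc.le (hw.trans_eq (by congr!)) (17 ^ m)).trans
    (density_pow_le_density_blowup 17 P)
  obtain ⟨A, hA, hblow⟩ : ∃ A : Finset (Fin m → Fin 17 → V),
      (∀ G ∈ A, ∀ σ : Fin m → Fin 17, P fun i => G i (σ i)) ∧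
        c ^ 17 ^ m ≤ (#A : ℝ) / Fintype.card V ^ (17 * m) :=
    ⟨_, fun G hG => ((@Finset.mem_filter _ _ (_) _ G).1 hG).2, hblow⟩
  have hlarge : (m * 17) ^ 2 * Fintype.card V ^ (m * 17) < #A * Fintype.card V := by
    rw [le_div_iff₀ (by positivity), mul_comm 17 m] at hblow
    have hpos : (0 : ℝ) < Fintype.card V ^ (m * 17) := by positivity
    have : ((m * 17 : ℕ) : ℝ) ^ 2 * Fintype.card V ^ (m * 17) < #A * Fintype.card V := by
      nlinarith
    exact_mod_cast this
  obtain ⟨G', hG', hGinj⟩ := exists_injective_of_lt_card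
    (A.map (Equiv.curry (Fin m) (Fin 17) V).symm.toEmbedding)
    (by rwa [Finset.card_map, Fintype.card_prod, Fintype.card_fin, Fintype.card_fin])
  obtain ⟨G, hGA, rfl⟩ := Finset.mem_map.1 hG'
  have hG : ∀ σ : Fin m → Fin 17, P fun i => G i (σ i) := hA G hGA
  have hdist : ∀ i, w (i - 1) ≠ w i ∧ w (i - 1) ≠ w (i + 1) ∧ w i ≠ w (i + 1) := by
    intro i
    have h3 := hH _ (hG (fun _ => 0) i)
    obtain ⟨h₁, h₂, h₃⟩ := Finset.card_triple_eq_three_iff.1 h3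
    exact ⟨fun h => h₁ (by rw [h]), fun h => h₂ (by rw [h]), fun h => h₃ (by rw [h])⟩
  refine ⟨fun i => G (w i) i, fun i j hij => ?_, fun i => ?_⟩
  · exact congrArg Prod.snd (@hGinj (w i, i) (w j, j) hij)
  · obtain ⟨h₁, h₂, h₃⟩ := hdist i
    have := hG (fun a => (if a = w (i - 1) then i - 1 else if a = w i then i else i + 1 : ZMod 17)) i
    simpa only [if_true, if_neg h₁.symm, if_neg h₂.symm, if_neg h₃.symm] using this

lemma minCodeg_le_codeg {V : Type*} [DecidableEq V] (H : Finset (Finset V)) {u v : V}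
    (huv : u ≠ v) : minCodeg H ≤ codeg H u v :=
  Nat.sInf_le ⟨u, v, huv, rfl⟩

open Classical in
lemma codeg_eq_card {V : Type*} [Fintype V] [DecidableEq V] (H : Finset (Finset V)) (u v : V) :
    codeg H u v = #{w | ({u, v, w} : Finset V) ∈ H} := by
  rw [codeg, ← Set.ncard_coe_finset]
  simp

open Classical in
/-- A large `3`-uniform hypergraph whose minimum codegree is at least `(1 / 3 + ε) n` contains the
tight cycle of length `17`. -/
theorem exists_hasTightCycle_of_le_minCodeg {ε : ℝ} (hε : 0 < ε) (hε₁ : ε ≤ 1 / 3) :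
    ∃ n₀ : ℕ, ∀ n, n₀ ≤ n → ∀ H : Finset (Finset (Fin n)), IsUniform3 H →
      (1 / 3 + ε) * n ≤ minCodeg H → HasTightCycle 17 H := by
  obtain ⟨M, n₀, hM, hsample⟩ := exists_sample_size hε hε₁
  have : NeZero (3 * M) := ⟨by omega⟩
  have : Nontrivial (Fin (3 * M)) := Fin.nontrivial_iff_two_le.2 (by omega)
  set c : ℝ := 1 / (2 * (3 * M : ℕ) ^ 17) with hc
  have hc₀ : 0 < c := by
    have : 0 < 3 * M := by omega
    positivity
  obtain ⟨n₁, hn₁⟩ := exists_nat_gt (((3 * M * 17 : ℕ) : ℝ) ^ 2 / c ^ 17 ^ (3 * M))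
  refine ⟨max n₀ (max n₁ 1), fun n hn H hH hcodeg => ?_⟩
  have hn₀ : n₀ ≤ n := (le_max_left _ _).trans hn
  have hn₁' : n₁ ≤ n := (le_max_left _ _).trans ((le_max_right _ _).trans hn)
  have hn₂ : 1 ≤ n := (le_max_right _ _).trans ((le_max_right _ _).trans hn)
  have : Nonempty (Fin n) := ⟨⟨0, hn₂⟩⟩
  have hnpos : (0 : ℝ) < n := by exact_mod_cast hn₂
  obtain ⟨S, hS, hgood⟩ := hsample (Fin n) (fun a b => {v | {a, b, v} ∈ H}) (by simpa using hn₀)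
    fun a b hab => by
      rw [Fintype.card_fin, ← codeg_eq_card]
      exact hcodeg.trans (Nat.cast_le.2 (minCodeg_le_codeg H hab))
  rw [Fintype.card_fin] at hgood
  have hsub : S ⊆ (univ : Finset (ZMod 17 → Fin (3 * M))).biUnion fun w =>
        {g | ∀ i, {g (w (i - 1)), g (w i), g (w (i + 1))} ∈ H} := by
    intro g hg
    obtain ⟨w, hw⟩ := hasClosedWalk17_of_card_lt (V := Fin (3 * M))
      (E := fun i j k => {g i, g j, g k} ∈ H)
      (fun x y z h => by rwa [Finset.insert_comm])
      (fun x y z h => by rwa [Finset.pair_comm (g z)])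
      (fun x y z h hxy => (Finset.card_triple_eq_three_iff.1 (hH _ h)).1 (by rw [hxy]))
      (fun x y hxy => by
        rw [Fintype.card_fin]
        refine (Nat.mul_lt_mul_left (by norm_num)).2 ((hS g hg x y hxy).trans_eq ?_)
        congr 1
        ext
        simp)
    simp only [Finset.mem_biUnion, Finset.mem_filter, Finset.mem_univ, true_and]
    exact ⟨w, hw⟩
  have hsum := (Finset.card_le_card hsub).trans Finset.card_biUnion_le
  obtain ⟨w, -, hw⟩ : ∃ w ∈ (univ : Finset (ZMod 17 → Fin (3 * M))), c * n ^ (3 * M) ≤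
      (#{g : Fin (3 * M) → Fin n | ∀ i, {g (w (i - 1)), g (w i), g (w (i + 1))} ∈ H} : ℝ) := by
    refine Finset.exists_le_of_sum_le ⟨fun _ => 0, Finset.mem_univ _⟩ ?_
    rw [Finset.sum_const, nsmul_eq_mul, Finset.card_univ, Fintype.card_fun, ZMod.card,
      Fintype.card_fin, ← Nat.cast_sum]
    refine le_trans ?_ (Nat.cast_le.2 hsum)
    have : (((3 * M) ^ 17 : ℕ) : ℝ) * (c * n ^ (3 * M)) = n ^ (3 * M) / 2 := by
      have : ((3 * M : ℕ) : ℝ) ≠ 0 := by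
        have : 3 * M ≠ 0 := by omega
        exact_mod_cast this
      rw [hc, Nat.cast_pow]
      field_simp
    linarith
  refine hasTightCycle_of_density hH w hc₀ ?_ ?_
  · rwa [Fintype.card_fin, le_div_iff₀ (by positivity)]
  · rw [Fintype.card_fin]
    rw [div_lt_iff₀' (by positivity)] at hn₁
    refine hn₁.trans_le ?_
    gcongr

end UpperBound

section LowerBound

/-- The extremal construction: the triples of vertices whose sum is `1` modulo `3`. -/
def sumOneTriples (n : ℕ) : Finset (Finset (Fin n)) :=
  {e | #e = 3 ∧ ∑ v ∈ e, (v.val : ZMod 3) = 1}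

lemma isUniform3_sumOneTriples (n : ℕ) : IsUniform3 (sumOneTriples n) :=
  fun _ he => (Finset.mem_filter.1 he).2.1

lemma triple_mem_sumOneTriples {n : ℕ} {u v w : Fin n} :
    {u, v, w} ∈ sumOneTriples n ↔ (u ≠ v ∧ u ≠ w ∧ v ≠ w) ∧
      (u.val : ZMod 3) + v.val + w.val = 1 := by
  rw [sumOneTriples, Finset.mem_filter, Finset.card_triple_eq_three_iff]
  refine ⟨fun ⟨_, h, hs⟩ => ⟨h, ?_⟩, fun ⟨h, hs⟩ => ⟨Finset.mem_univ _, h, ?_⟩⟩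
  · rwa [Finset.sum_insert (by simp [h.1, h.2.1]), Finset.sum_pair h.2.2, ← add_assoc] at hs
  · rwa [Finset.sum_insert (by simp [h.1, h.2.1]), Finset.sum_pair h.2.2, ← add_assoc]

lemma not_hasTightCycle_sumOneTriples (n : ℕ) : ¬ HasTightCycle 17 (sumOneTriples n) := by
  rintro ⟨x, -, hx⟩
  set f : ZMod 17 → ZMod 3 := fun i => (x i).val with hf
  have hsum : ∀ i, f (i - 1) + f i + f (i + 1) = 1 := fun i =>
    (triple_mem_sumOneTriples.1 (hx i)).2
  have hper : ∀ i, f (i + 3) = f i := by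
    intro i
    have h₁ := hsum (i + 1)
    have h₂ := hsum (i + 2)
    rw [show i + 1 - 1 = i by ring, show i + 1 + 1 = i + 2 by ring] at h₁
    rw [show i + 2 - 1 = i + 1 by ring, show i + 2 + 1 = i + 3 by ring] at h₂
    linear_combination h₂ - h₁
  have hone : ∀ i, f (i + 1) = f i := by
    intro i
    rw [← hper i, ← hper (i + 3), ← hper (i + 3 + 3), ← hper (i + 3 + 3 + 3),
      ← hper (i + 3 + 3 + 3 + 3), ← hper (i + 3 + 3 + 3 + 3 + 3)]
    congr 1
    rw [show i + 3 + 3 + 3 + 3 + 3 + 3 = i + 1 + 17 by ring, show (17 : ZMod 17) = 0 from rfl,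
      add_zero]
  have h := hsum 1
  have h₀ := hone 0
  have h₁ := hone 1
  rw [zero_add] at h₀
  rw [sub_self, h₁, h₀] at h
  have : ∀ a : ZMod 3, a + a + a ≠ 1 := by decide
  exact this _ h

lemma le_codeg_sumOneTriples {n : ℕ} {u v : Fin n} (huv : u ≠ v) :
    n / 3 - 2 ≤ codeg (sumOneTriples n) u v := by
  set r : ZMod 3 := 1 - u.val - v.val with hr
  have hr3 : r.val < 3 := ZMod.val_lt r
  let φ : Fin (n / 3) → Fin n := fun k => ⟨3 * k + r.val, by have := k.2; omega⟩
  have hφ : Function.Injective φ := fun k l h => by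
    have := congrArg Fin.val h
    simp only [φ] at this
    exact Fin.ext (by omega)
  have hsub : univ.image φ \ {u, v} ⊆
      ({w | ({u, v, w} : Finset (Fin n)) ∈ sumOneTriples n} : Finset (Fin n)) := by
    intro w hw
    simp only [Finset.mem_sdiff, Finset.mem_image, Finset.mem_univ, true_and, Finset.mem_insert,
      Finset.mem_singleton, not_or] at hw
    obtain ⟨⟨k, rfl⟩, hu, hv⟩ := hw
    rw [Finset.mem_filter, triple_mem_sumOneTriples]
    refine ⟨Finset.mem_univ _, ⟨huv, Ne.symm hu, Ne.symm hv⟩, ?_⟩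
    simp only [φ, Nat.cast_add, Nat.cast_mul, ZMod.natCast_val, ZMod.cast_id', id, hr]
    rw [show ((3 : ℕ) : ZMod 3) = 0 from rfl]
    ring
  rw [codeg_eq_card]
  calc n / 3 - 2 ≤ #(univ.image φ) - #({u, v} : Finset (Fin n)) := by
        rw [Finset.card_image_of_injective _ hφ, Finset.card_univ, Fintype.card_fin]
        exact Nat.sub_le_sub_left Finset.card_le_two _
    _ ≤ #(univ.image φ \ {u, v}) := Finset.le_card_sdiff _ _
    _ ≤ _ := by
        convert Finset.card_le_card hsub

lemma le_minCodeg_sumOneTriples {n : ℕ} (hn : 2 ≤ n) :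
    n / 3 - 2 ≤ minCodeg (sumOneTriples n) := by
  obtain ⟨u, v, huv, h⟩ := Nat.sInf_mem (s := {d : ℕ | ∃ u v : Fin n, u ≠ v ∧
    codeg (sumOneTriples n) u v = d}) ⟨_, ⟨0, by omega⟩, ⟨1, by omega⟩, by simp, rfl⟩
  exact (le_codeg_sumOneTriples huv).trans_eq h

end LowerBound

lemma minCodeg_le_card {V : Type*} [Fintype V] [DecidableEq V] (H : Finset (Finset V)) :
    minCodeg H ≤ Fintype.card V := by
  classical
  by_cases h : ∃ u v : V, u ≠ v
  · obtain ⟨u, v, huv⟩ := h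
    refine (minCodeg_le_codeg H huv).trans ?_
    rw [codeg_eq_card]
    exact Finset.card_le_univ _
  · push Not at h
    have : {d : ℕ | ∃ u v : V, u ≠ v ∧ codeg H u v = d} = ∅ :=
      Set.eq_empty_of_forall_notMem fun _ ⟨u, v, huv, _⟩ => huv (h u v)
    simp [minCodeg, this]

lemma le_exCodeg {n : ℕ} (hn : 2 ≤ n) : n / 3 - 2 ≤ exCodeg 17 n := by
  refine (le_minCodeg_sumOneTriples hn).trans (le_csSup ⟨n, ?_⟩
    ⟨_, isUniform3_sumOneTriples n, not_hasTightCycle_sumOneTriples n, rfl⟩)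
  rintro _ ⟨H, -, -, rfl⟩
  simpa using minCodeg_le_card H

lemma exists_exCodeg_le {ε : ℝ} (hε : 0 < ε) (hε₁ : ε ≤ 1 / 3) :
    ∃ n₀ : ℕ, ∀ n, n₀ ≤ n → (exCodeg 17 n : ℝ) ≤ (1 / 3 + ε) * n := by
  obtain ⟨n₀, h⟩ := exists_hasTightCycle_of_le_minCodeg hε hε₁
  refine ⟨n₀, fun n hn => (Nat.le_floor_iff (by positivity)).1 (csSup_le' ?_)⟩
  rintro _ ⟨H, hH, hfree, rfl⟩
  by_contra! hlt
  exact hfree (h n hn H hH (Nat.lt_of_floor_lt hlt).le)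

end TightCycle

/-- The codegree Turán density of the tight cycle `C₁₇` equals `1/3`. -/
theorem codegree_turan_density_C17 :
    Filter.Tendsto (fun n : ℕ => (exCodeg 17 n : ℝ) / n) Filter.atTop (nhds (1 / 3)) := by
  refine tendsto_order.2 ⟨fun a ha => ?_, fun b hb => ?_⟩
  · obtain ⟨n₁, hn₁⟩ := exists_nat_gt (3 / (1 / 3 - a))
    filter_upwards [Filter.eventually_ge_atTop (max n₁ 2)] with n hn
    have hn₂ : 2 ≤ n := (le_max_right _ _).trans hn
    have hn₀ : (0 : ℝ) < n := by exact_mod_cast (by omega : 0 < n)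
    have hn' : (n₁ : ℝ) ≤ n := by exact_mod_cast (le_max_left _ _).trans hn
    have h : (n : ℝ) ≤ 3 * exCodeg 17 n + 8 := by
      have := TightCycle.le_exCodeg hn₂
      exact_mod_cast (by omega : n ≤ 3 * exCodeg 17 n + 8)
    have h' := (div_lt_iff₀ (by linarith)).1 (hn₁.trans_le hn')
    rw [lt_div_iff₀ hn₀]
    nlinarith
  · obtain ⟨n₀, h⟩ := TightCycle.exists_exCodeg_le (ε := min (1 / 3) ((b - 1 / 3) / 2))
      (lt_min (by norm_num) (by linarith)) (min_le_left _ _)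
    filter_upwards [Filter.eventually_ge_atTop (max n₀ 1)] with n hn
    have hn₀ : (0 : ℝ) < n := by exact_mod_cast (le_max_right _ _).trans hn
    rw [div_lt_iff₀ hn₀]
    refine (h n ((le_max_left _ _).trans hn)).trans_lt ?_
    gcongr
    linarith [min_le_right (1 / 3) ((b - 1 / 3) / 2)]
end

section
/- For every ε > 0 there exists n₀ such that for every n ≥ n₀, every 3-uniform hypergraph H on n vertices with minimum codegree δ₂(H) ≥ (1/3 + ε)n contains a copy of the tight cycle C₁₁ as a subgraph, i.e., there exist 11 distinct vertices x₁,…,x₁₁ of H such that {x_{i−1},x_i,x_{i+1}} ∈ E(H) for all i with indices taken modulo 11. -/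
open Finset

/-- Eleven vertices whose cyclically consecutive triples all satisfy `R` form a closed tight
walk of length eleven. -/
theorem exists_closedWalk_eleven {α : Type*} {R : α → α → α → Prop}
    {a₀ a₁ a₂ a₃ a₄ a₅ a₆ a₇ a₈ a₉ b : α}
    (h₀ : R b a₀ a₁) (h₁ : R a₀ a₁ a₂) (h₂ : R a₁ a₂ a₃) (h₃ : R a₂ a₃ a₄) (h₄ : R a₃ a₄ a₅)
    (h₅ : R a₄ a₅ a₆) (h₆ : R a₅ a₆ a₇) (h₇ : R a₆ a₇ a₈) (h₈ : R a₇ a₈ a₉) (h₉ : R a₈ a₉ b)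
    (h : R a₉ b a₀) :
    ∃ x : ZMod 11 → α, ∀ i, R (x (i - 1)) (x i) (x (i + 1)) := by
  refine ⟨(![a₀, a₁, a₂, a₃, a₄, a₅, a₆, a₇, a₈, a₉, b] : Fin 11 → α), fun i => ?_⟩
  change Fin 11 at i
  fin_cases i
  exacts [h₀, h₁, h₂, h₃, h₄, h₅, h₆, h₇, h₈, h₉, h]

/-- The pairs of a finite type cannot be partitioned into an orientation `arc` and a relation
`flat` such that every vertex with an out-arc has `flat`-degree above a third of the vertices, and
every vertex with a `flat` neighbour has out-degree above a third of the vertices. -/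
theorem not_trichotomous_of_degree {α : Type*} [Fintype α] [DecidableEq α] [Nontrivial α]
    (arc flat : α → α → Prop) [DecidableRel arc] [DecidableRel flat]
    (irr : ∀ u, ¬ arc u u) (irr' : ∀ u, ¬ flat u u)
    (total : ∀ u v, u ≠ v → arc u v ∨ arc v u ∨ flat u v)
    (asymm : ∀ u v, arc u v → ¬ arc v u) (excl : ∀ u v, flat u v → ¬ arc u v ∧ ¬ arc v u)
    (hflat : ∀ u v, arc u v → Fintype.card α < 3 * #{w | flat u w})
    (hout : ∀ u v, flat u v → Fintype.card α < 3 * #{w | arc u w}) : False := by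
  have hsum : ∑ u, (#{w | arc u w} : ℤ) = ∑ u, (#{w | arc w u} : ℤ) := by
    have := sum_card_bipartiteAbove_eq_sum_card_bipartiteBelow (s := univ) (t := univ) arc
    unfold bipartiteAbove bipartiteBelow at this
    exact_mod_cast this
  have hdeg : ∀ u, #{w | arc u w} + #{w | arc w u} + #{w | flat u w} + 1 = Fintype.card α := by
    intro u
    rw [← card_union_of_disjoint, ← card_union_of_disjoint, ← card_singleton u,
      ← card_union_of_disjoint, ← card_univ]
    · congr 1
      ext v
      have := total u v
      simp only [mem_union, mem_filter_univ, mem_singleton, mem_univ, iff_true]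
      by_cases h : v = u <;> grind
    all_goals
      rw [disjoint_left]
      intro v
      simp only [mem_union, mem_filter_univ, mem_singleton]
      grind
  have hpos : ∀ {u v : α} {r : α → α → Prop} [DecidableRel r], r u v → 0 < #{w | r u w} :=
    fun {u v r} _ h => card_pos.mpr ⟨v, by simpa using h⟩
  have hex : ∀ u, 0 < #{w | arc u w} ∨ 0 < #{w | flat u w} →
      (2 : ℤ) ≤ #{w | arc u w} - #{w | arc w u} := by
    intro u hu
    have h₁ : Fintype.card α < 3 * #{w | arc u w} ∧ Fintype.card α < 3 * #{w | flat u w} := by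
      rcases hu with hu | hu
      · obtain ⟨v, hv⟩ := card_pos.mp hu
        have h := hflat u v (by simpa using hv)
        obtain ⟨w, hw⟩ := card_pos.mp (show 0 < #{w | flat u w} by omega)
        exact ⟨hout u w (by simpa using hw), h⟩
      · obtain ⟨v, hv⟩ := card_pos.mp hu
        have h := hout u v (by simpa using hv)
        obtain ⟨w, hw⟩ := card_pos.mp (show 0 < #{w | arc u w} by omega)
        exact ⟨h, hflat u w (by simpa using hw)⟩
    have := hdeg u
    omega
  obtain ⟨s, hs⟩ : ∃ s, ∀ u, u ≠ s → 0 < #{w | arc u w} ∨ 0 < #{w | flat u w} := by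
    by_contra! h
    obtain ⟨u₀⟩ : Nonempty α := inferInstance
    obtain ⟨u, -, hu⟩ := h u₀
    obtain ⟨v, hvu, hv⟩ := h u
    have h₁ : ∀ w, ¬ arc u w ∧ ¬ flat u w := fun w =>
      ⟨fun h => absurd (hpos h) (by omega), fun h => absurd (hpos h) (by omega)⟩
    have h₂ : ∀ w, ¬ arc v w ∧ ¬ flat v w := fun w =>
      ⟨fun h => absurd (hpos h) (by omega), fun h => absurd (hpos h) (by omega)⟩
    have := total u v hvu.symm
    grind
  have hle : ∀ u, (2 - if u = s then (Fintype.card α + 1 : ℤ) else 0) ≤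
      #{w | arc u w} - #{w | arc w u} := by
    intro u
    split_ifs with h
    · have := hdeg u
      omega
    · simpa using hex u (hs u h)
  have := sum_le_sum fun u (_ : u ∈ univ) => hle u
  rw [sum_sub_distrib, sum_sub_distrib, hsum] at this
  simp only [sum_const, card_univ, sum_ite_eq', mem_univ, if_true, nsmul_eq_mul] at this
  have := Fintype.one_lt_card (α := α)
  omega

/-- A symmetric ternary relation in which every pair has codegree above a third of the vertices
admits a closed tight walk of length eleven. -/
theorem exists_closedWalk_eleven_of_codegree {α : Type*} [Fintype α] [Nontrivial α]
    (R : α → α → α → Prop) [∀ a b, DecidablePred (R a b)]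
    (swap : ∀ a b c, R a b c → R b a c) (swap' : ∀ a b c, R a b c → R a c b)
    (ne : ∀ a b c, R a b c → a ≠ b)
    (hR : ∀ a b, a ≠ b → Fintype.card α < 3 * #{c | R a b c}) :
    ∃ x : ZMod 11 → α, ∀ i, R (x (i - 1)) (x i) (x (i + 1)) := by
  classical
  by_contra hno
  let arc : α → α → Prop := fun p q => ∃ z w, R q p z ∧ R q z w ∧ R q w p
  let flat : α → α → Prop := fun p q => ∃ a w, R a p q ∧ R a q w ∧ R a w p
  have harc : ∀ p q, arc p q → arc q p → False := by
    rintro p q ⟨z, w, h₁, h₂, h₃⟩ ⟨z', w', k₁, k₂, k₃⟩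
    refine hno (exists_closedWalk_eleven (a₀ := p) (a₁ := q) (a₂ := z) (a₃ := p) (a₄ := q)
      (a₅ := z) (a₆ := w) (a₇ := q) (a₈ := p) (a₉ := z') (b := w') ?_ ?_ ?_ ?_ ?_ ?_ ?_ ?_ ?_ ?_ ?_)
    all_goals grind only
  have harc_flat : ∀ p q, arc p q → flat p q → False := by
    rintro p q ⟨z, w, h₁, h₂, h₃⟩ ⟨a, w', k₁, k₂, k₃⟩
    refine hno (exists_closedWalk_eleven (a₀ := q) (a₁ := p) (a₂ := z) (a₃ := q) (a₄ := w)
      (a₅ := p) (a₆ := q) (a₇ := a) (a₈ := p) (a₉ := w') (b := a) ?_ ?_ ?_ ?_ ?_ ?_ ?_ ?_ ?_ ?_ ?_)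
    all_goals grind only
  have flat_symm : ∀ p q, flat p q → flat q p := by
    rintro p q ⟨a, w, h₁, h₂, h₃⟩
    exact ⟨a, w, by grind only, by grind only, by grind only⟩
  have inter : ∀ x y z, R x y z → (∃ w, R x y w ∧ R y z w) ∨ (∃ w, R y z w ∧ R z x w) ∨
      ∃ w, R z x w ∧ R x y w := by
    intro x y z h
    by_contra! hd
    have h₁ := hR x y (ne _ _ _ h)
    have h₂ := hR y z (ne y z x (by grind only))
    have h₃ := hR z x (ne z x y (by grind only))
    have hle : #(({c | R x y c} : Finset α) ∪ ({c | R y z c} : Finset α) ∪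
      ({c | R z x c} : Finset α)) ≤ Fintype.card α := card_le_univ _
    rw [card_union_of_disjoint, card_union_of_disjoint] at hle
    · omega
    all_goals
      rw [disjoint_left]
      intro v
      simp only [mem_union, mem_filter_univ]
      grind only
  have edge : ∀ x y z, R x y z → (arc x y ∧ arc z y ∧ flat x z) ∨
      (arc y z ∧ arc x z ∧ flat y x) ∨ (arc z x ∧ arc y x ∧ flat z y) := by
    have key : ∀ x y z w, R x y z → R x y w → R y z w → arc x y ∧ arc z y ∧ flat x z :=
      fun x y z w h h₁ h₂ => ⟨⟨z, w, by grind only, by grind only, by grind only⟩,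
        ⟨x, w, by grind only, by grind only, by grind only⟩,
        ⟨y, w, by grind only, by grind only, by grind only⟩⟩
    intro x y z h
    rcases inter x y z h with ⟨w, h₁, h₂⟩ | ⟨w, h₁, h₂⟩ | ⟨w, h₁, h₂⟩
    · exact .inl (key x y z w h h₁ h₂)
    · exact .inr (.inl (key y z x w (by grind only) h₁ h₂))
    · exact .inr (.inr (key z x y w (by grind only) h₁ h₂))
  have arc_ne : ∀ p q, arc p q → p ≠ q := by
    rintro p q ⟨z, w, h, -⟩
    exact (ne _ _ _ h).symm
  have flat_ne : ∀ p q, flat p q → p ≠ q := by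
    rintro p q ⟨z, w, h, -⟩
    exact ne p q z (by grind only)
  refine not_trichotomous_of_degree arc flat (fun u h => arc_ne u u h rfl)
    (fun u h => flat_ne u u h rfl) (fun u v huv => ?_) (fun u v h h' => harc u v h h')
    (fun u v h => ⟨fun h' => harc_flat _ _ h' h, fun h' => harc_flat _ _ h' (flat_symm _ _ h)⟩)
    (fun u v h => (hR u v (arc_ne u v h)).trans_le ?_)
    (fun u v h => (hR u v (flat_ne u v h)).trans_le ?_)
  · obtain ⟨w, hw⟩ := card_pos.mp (show 0 < #{c | R u v c} by have := hR u v huv; omega)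
    have := edge u v w (by simpa using hw)
    grind only
  · gcongr with w
    intro hw
    rcases edge u v w hw with h' | h' | h'
    · exact h'.2.2
    · exact (harc_flat u v h (flat_symm _ _ h'.2.2)).elim
    · exact (harc u v h h'.2.1).elim
  · gcongr with w
    intro hw
    rcases edge u v w hw with h' | h' | h'
    · exact (harc_flat u v h'.1 h).elim
    · exact h'.2.1
    · exact (harc_flat v u h'.2.1 (flat_symm _ _ h)).elim

theorem card_mul_card_filter_apply_eq {ι V : Type*} [Fintype ι] [DecidableEq ι] [Fintype V]
    [DecidableEq V] {i j : ι} (hij : i ≠ j) :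
    Fintype.card V * #{f : ι → V | f i = f j} ≤ Fintype.card V ^ Fintype.card ι := by
  rw [← Fintype.card_fun, ← card_univ, ← card_univ, ← card_product]
  refine card_le_card_of_injOn (fun p => Function.update p.2 j p.1) (by simp) ?_
  rintro ⟨a, f⟩ hf ⟨b, g⟩ hg h
  simp only [coe_product, coe_filter, Set.mem_prod, Set.mem_ofPred_eq, mem_univ, true_and] at hf hg
  have hk := fun k => congrFun h k
  have hab : a = b := by simpa using hk j
  have hfg : ∀ k, k ≠ j → f k = g k := fun k hkj => by
    simpa [Function.update_of_ne hkj] using hk k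
  refine Prod.ext hab (funext fun k => ?_)
  by_cases h : k = j
  · subst h
    simpa only [hf.2, hg.2] using hfg i hij
  · exact hfg k h

theorem card_mul_card_filter_not_injective {ι V : Type*} [Fintype ι] [DecidableEq ι] [Fintype V]
    [DecidableEq V] :
    Fintype.card V * #{f : ι → V | ¬ Function.Injective f} ≤
      Fintype.card ι ^ 2 * Fintype.card V ^ Fintype.card ι := by
  have hsub : ({f : ι → V | ¬ Function.Injective f} : Finset (ι → V)) ⊆
      (univ : Finset ι).offDiag.biUnion fun p => {f | f p.1 = f p.2} := by
    intro f hf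
    simp only [mem_filter_univ, Function.Injective, not_forall] at hf
    obtain ⟨i, j, h, hij⟩ := hf
    simp only [mem_biUnion, mem_offDiag, mem_filter_univ]
    exact ⟨(i, j), by simpa using hij, h⟩
  calc
    _ ≤ Fintype.card V * ∑ p ∈ (univ : Finset ι).offDiag, #{f : ι → V | f p.1 = f p.2} := by
      gcongr
      exact (card_le_card hsub).trans card_biUnion_le
    _ ≤ ∑ p ∈ (univ : Finset ι).offDiag, Fintype.card V ^ Fintype.card ι := by
      rw [mul_sum]
      exact sum_le_sum fun p hp =>
        card_mul_card_filter_apply_eq (by simpa using hp)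
    _ ≤ _ := by
      rw [sum_const, smul_eq_mul]
      gcongr
      rw [offDiag_card, card_univ, sq]
      exact Nat.sub_le _ _

theorem sum_card_filter_forall_cons_mem {V : Type*} [Fintype V] [DecidableEq V] (k t : ℕ)
    (S : Finset (Fin (k + 1) → V)) :
    ∑ u : Fin t → V, #{f : Fin k → V | ∀ j, (Fin.cons (u j) f : Fin (k + 1) → V) ∈ S} =
      ∑ f : Fin k → V, #{v | (Fin.cons v f : Fin (k + 1) → V) ∈ S} ^ t := by
  have := sum_card_bipartiteAbove_eq_sum_card_bipartiteBelow (s := univ) (t := univ)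
    fun (u : Fin t → V) (f : Fin k → V) => ∀ j, (Fin.cons (u j) f : Fin (k + 1) → V) ∈ S
  unfold bipartiteAbove bipartiteBelow at this
  rw [this]
  refine sum_congr rfl fun f _ => ?_
  rw [← Fintype.card_piFinset_const]
  congr 1
  ext u
  simp

theorem sum_card_filter_cons_mem {V : Type*} [Fintype V] [DecidableEq V] (k : ℕ)
    (S : Finset (Fin (k + 1) → V)) :
    ∑ f : Fin k → V, #{v | (Fin.cons v f : Fin (k + 1) → V) ∈ S} = #S := by
  rw [← card_sigma]
  refine card_nbij' (fun p => Fin.cons p.2 p.1) (fun g => ⟨Fin.tail g, g 0⟩) ?_ ?_ ?_ ?_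
  · intro p; simp
  · intro g; simp
  · intro p _; simp
  · intro p _; simp

/-- A dense family of tuples contains a `t`-fold blow-up of a tuple, with distinct entries in
each coordinate. -/
theorem exists_blowup (t k : ℕ) : ∀ c : ℝ, 0 < c → ∃ n₀ : ℕ, ∀ n : ℕ, n₀ ≤ n →
    ∀ S : Finset (Fin k → Fin n), c * (n : ℝ) ^ k ≤ #S →
      ∃ F : Fin k → Fin t → Fin n, (∀ i, Function.Injective (F i)) ∧
        ∀ s : Fin k → Fin t, (fun i => F i (s i)) ∈ S := by
  induction k with
  | zero =>
    refine fun c hc => ⟨0, fun n _ S hS => ⟨fun i => i.elim0, fun i => i.elim0, fun s => ?_⟩⟩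
    have hpos : 0 < #S := by
      have : (0 : ℝ) < #S := lt_of_lt_of_le (by simpa using hc) hS
      exact_mod_cast this
    obtain ⟨f, hf⟩ := card_pos.mp hpos
    convert hf
  | succ k ih =>
    intro c hc
    obtain ⟨n₁, hn₁⟩ := ih (c ^ t / 2) (by positivity)
    obtain ⟨n₂, hn₂⟩ := exists_nat_gt ((t : ℝ) ^ 2 / (c ^ t / 2))
    refine ⟨max n₁ (max n₂ 1), fun n hn S hS => ?_⟩
    have hn1 : n₁ ≤ n := (le_max_left _ _).trans hn
    have hn2 : n₂ ≤ n := (le_max_left _ _).trans ((le_max_right _ _).trans hn)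
    have hn3 : 1 ≤ n := (le_max_right _ _).trans ((le_max_right _ _).trans hn)
    have hn0 : (0 : ℝ) < n := by exact_mod_cast hn3
    let D : (Fin t → Fin n) → Finset (Fin k → Fin n) :=
      fun u => {f | ∀ j, (Fin.cons (u j) f : Fin (k + 1) → Fin n) ∈ S}
    have hmoment : c ^ t * (n : ℝ) ^ (k + t) ≤ ∑ u, (#(D u) : ℝ) := by
      have h₁ := pow_sum_div_card_le_sum_pow (s := (univ : Finset (Fin k → Fin n)))
        (f := fun f => (#{v | (Fin.cons v f : Fin (k + 1) → Fin n) ∈ S} : ℝ))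
        (fun _ _ => by positivity) (t - 1)
      have h₂ : ∑ f : Fin k → Fin n, (#{v | (Fin.cons v f : Fin (k + 1) → Fin n) ∈ S} : ℝ) = #S := by
        exact_mod_cast sum_card_filter_cons_mem k S
      have h₃ : ∑ u, (#(D u) : ℝ) = ∑ f : Fin k → Fin n,
          (#{v | (Fin.cons v f : Fin (k + 1) → Fin n) ∈ S} : ℝ) ^ t := by
        exact_mod_cast sum_card_filter_forall_cons_mem k t S
      rcases t.eq_zero_or_pos with rfl | ht
      · rw [h₃]
        simp
      rw [Nat.sub_add_cancel ht, h₂, ← h₃, card_univ, Fintype.card_fun, Fintype.card_fin,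
        Fintype.card_fin] at h₁
      refine le_trans ?_ h₁
      push_cast
      rw [le_div_iff₀ (by positivity)]
      refine le_trans (le_of_eq ?_) (pow_le_pow_left₀ (by positivity) hS t)
      obtain ⟨t, rfl⟩ := Nat.exists_eq_add_of_le' ht
      simp only [Nat.add_sub_cancel]
      ring
    have hbad : (#{u : Fin t → Fin n | ¬ Function.Injective u} : ℝ) < c ^ t / 2 * n ^ t := by
      have h := card_mul_card_filter_not_injective (ι := Fin t) (V := Fin n)
      simp only [Fintype.card_fin] at h
      have h' : (n : ℝ) * #{u : Fin t → Fin n | ¬ Function.Injective u} ≤ t ^ 2 * n ^ t := by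
        exact_mod_cast h
      rw [div_lt_iff₀ (by positivity)] at hn₂
      have hn₂' : (n₂ : ℝ) ≤ n := by exact_mod_cast hn2
      refine lt_of_mul_lt_mul_left (h'.trans_lt ?_) hn0.le
      calc (t : ℝ) ^ 2 * n ^ t < n₂ * (c ^ t / 2) * n ^ t := by gcongr
        _ ≤ n * (c ^ t / 2) * n ^ t := by gcongr
        _ = _ := by ring
    obtain ⟨u, hu, hDu⟩ : ∃ u : Fin t → Fin n, Function.Injective u ∧
        c ^ t / 2 * (n : ℝ) ^ k ≤ #(D u) := by
      by_contra! hno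
      have hle : ∀ u, (#(D u) : ℝ) ≤ c ^ t / 2 * n ^ k +
          if ¬ Function.Injective u then (n : ℝ) ^ k else 0 := by
        intro u
        by_cases hu : Function.Injective u
        · simpa [hu] using (hno u hu).le
        · have : (#(D u) : ℝ) ≤ n ^ k := by
            have : #(D u) ≤ n ^ k := (card_le_univ _).trans (by simp)
            exact_mod_cast this
          simp only [hu, not_false_eq_true, if_true]
          have : 0 ≤ c ^ t / 2 * (n : ℝ) ^ k := by positivity
          linarith
      have h := hmoment.trans (sum_le_sum fun u _ => hle u)
      rw [sum_add_distrib, ← sum_filter, sum_const, sum_const, card_univ, Fintype.card_fun,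
        Fintype.card_fin, Fintype.card_fin, nsmul_eq_mul, nsmul_eq_mul, pow_add] at h
      push_cast at h
      have : (#{u : Fin t → Fin n | ¬ Function.Injective u} : ℝ) * n ^ k <
        c ^ t / 2 * n ^ t * n ^ k := by gcongr
      linarith
    obtain ⟨F, hF, hFS⟩ := hn₁ n hn1 (D u) hDu
    refine ⟨Fin.cons u F, Fin.cases hu hF, fun s => ?_⟩
    have h := hFS (fun i => s i.succ)
    simp only [D, mem_filter_univ] at h
    convert h (s 0) using 1
    funext i
    refine Fin.cases ?_ (fun i => ?_) i <;> simp

theorem sum_prod_sdiff_pair_of_fixed {ι V : Type*} [Fintype ι] [DecidableEq ι] [Fintype V]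
    [DecidableEq V] {i j : ι} (hij : i ≠ j) (a b : V) (w : V → ℝ) :
    ∑ f : ι → V with f i = a ∧ f j = b, ∏ k ∈ univ \ {i, j}, w (f k) =
      (∑ v, w v) ^ (Fintype.card ι - 2) := by
  let W : ι → V → ℝ := fun k v =>
    if k = i then (if v = a then 1 else 0) else if k = j then (if v = b then 1 else 0) else w v
  have hdisj : ∀ g : ι → ℝ, ∏ k, g k = (∏ k ∈ univ \ {i, j}, g k) * (g i * g j) := fun g => by
    rw [← prod_sdiff (subset_univ {i, j}), prod_pair hij]
  have hW : ∀ f : ι → V, ∏ k, W k (f k) =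
      if f i = a ∧ f j = b then ∏ k ∈ univ \ {i, j}, w (f k) else 0 := by
    intro f
    have h : ∏ k ∈ univ \ {i, j}, W k (f k) = ∏ k ∈ univ \ {i, j}, w (f k) := by
      refine prod_congr rfl fun k hk => ?_
      simp only [mem_sdiff, mem_univ, true_and, mem_insert, mem_singleton, not_or] at hk
      simp [W, hk]
    rw [hdisj, h]
    by_cases hi : f i = a <;> by_cases hj : f j = b <;> simp [W, hi, hj, hij.symm]
  have hprod := prod_univ_sum (fun _ : ι => (univ : Finset V)) W
  rw [Fintype.piFinset_univ, sum_congr rfl fun f _ => hW f, ← sum_filter, hdisj] at hprod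
  rw [← hprod]
  have h : ∏ k ∈ univ \ {i, j}, ∑ v, W k v = (∑ v, w v) ^ (Fintype.card ι - 2) := by
    rw [← card_pair hij, ← card_univ, ← card_sdiff_of_subset (subset_univ _), ← prod_const]
    refine prod_congr rfl fun k hk => ?_
    simp only [mem_sdiff, mem_univ, true_and, mem_insert, mem_singleton, not_or] at hk
    simp [W, hk]
  rw [h]
  simp [W, hij.symm]

/-- Exponential moment bound for the number of tuples in which the pair of positions `i, j`
sees few other positions in its neighbourhood. -/
theorem pow_mul_card_filter_card_le {ι V : Type*} [Fintype ι] [DecidableEq ι] [Fintype V]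
    [DecidableEq V] {i j : ι} (hij : i ≠ j) (N : V → V → Finset V) {θ x : ℝ} (hx : 0 < x)
    (hx' : x ≤ 1) (hN : ∀ a b, a ≠ b → θ * Fintype.card V ≤ #(N a b)) (q : ℕ) :
    x ^ q * #{f : ι → V | f i ≠ f j ∧ #{k | f k ∈ N (f i) (f j)} ≤ q} ≤
      (Fintype.card V : ℝ) ^ 2 *
        |(1 - (1 - x) * θ) * Fintype.card V| ^ (Fintype.card ι - 2) := by
  let w : V → V → V → ℝ := fun a b v => if v ∈ N a b then x else 1
  have hw : ∀ a b v, 0 < w a b v := fun a b v => by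
    simp only [w]
    split_ifs <;> positivity
  have hsum : ∀ a b, a ≠ b → ∑ v, w a b v ≤ (1 - (1 - x) * θ) * Fintype.card V := by
    intro a b hab
    have h₁ : ∑ v, w a b v = ∑ v, (1 - (1 - x) * if v ∈ N a b then 1 else 0) :=
      sum_congr rfl fun v _ => by
        simp only [w]
        split_ifs <;> ring
    rw [h₁, sum_sub_distrib, ← mul_sum]
    simp only [sum_const, card_univ, nsmul_eq_mul, mul_one, sum_boole, filter_univ_mem]
    have := mul_le_mul_of_nonneg_left (hN a b hab) (sub_nonneg.mpr hx')
    linarith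
  set B : Finset (ι → V) := {f | f i ≠ f j ∧ #{k | f k ∈ N (f i) (f j)} ≤ q} with hB
  have hprod : ∀ f ∈ B, x ^ q ≤ ∏ k ∈ univ \ {i, j}, w (f i) (f j) (f k) := by
    intro f hf
    simp only [hB, mem_filter_univ] at hf
    simp only [w]
    rw [prod_ite, prod_const, prod_const_one, mul_one]
    refine pow_le_pow_of_le_one hx.le hx' ((card_le_card ?_).trans hf.2)
    exact filter_subset_filter _ (subset_univ _)
  calc x ^ q * #B = ∑ f ∈ B, x ^ q := by rw [sum_const, nsmul_eq_mul, mul_comm]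
    _ ≤ ∑ f ∈ B, ∏ k ∈ univ \ {i, j}, w (f i) (f j) (f k) := sum_le_sum hprod
    _ = ∑ p : V × V, ∑ f ∈ B with (f i, f j) = p, ∏ k ∈ univ \ {i, j}, w (f i) (f j) (f k) :=
      (sum_fiberwise _ _ _).symm
    _ ≤ ∑ p : V × V, |(1 - (1 - x) * θ) * Fintype.card V| ^ (Fintype.card ι - 2) := by
      refine sum_le_sum fun p _ => ?_
      obtain ⟨a, b⟩ := p
      by_cases hab : a = b
      · rw [sum_eq_zero]
        · positivity
        · intro f hf
          simp only [hB, mem_filter, mem_univ, true_and, Prod.mk.injEq] at hf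
          exact absurd (hf.2.1.trans (hab.trans hf.2.2.symm)) hf.1.1
      calc ∑ f ∈ B with (f i, f j) = (a, b), ∏ k ∈ univ \ {i, j}, w (f i) (f j) (f k)
          = ∑ f ∈ B with (f i, f j) = (a, b), ∏ k ∈ univ \ {i, j}, w a b (f k) := by
            refine sum_congr rfl fun f hf => ?_
            simp only [mem_filter, Prod.mk.injEq] at hf
            rw [hf.2.1, hf.2.2]
        _ ≤ ∑ f : ι → V with f i = a ∧ f j = b, ∏ k ∈ univ \ {i, j}, w a b (f k) := by
            refine sum_le_sum_of_subset_of_nonneg (fun f hf => ?_)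
              fun f _ _ => prod_nonneg fun k _ => (hw a b _).le
            simp only [mem_filter, Prod.mk.injEq] at hf
            simpa using hf.2
        _ = (∑ v, w a b v) ^ (Fintype.card ι - 2) := sum_prod_sdiff_pair_of_fixed hij a b _
        _ ≤ _ := by
            exact pow_le_pow_left₀ (sum_nonneg fun v _ => (hw a b v).le)
              ((hsum a b hab).trans (le_abs_self _)) _
    _ = _ := by
      rw [sum_const, card_univ, Fintype.card_prod, nsmul_eq_mul]
      push_cast
      ring

/-- If every pair has codegree at least `(1/3 + ε) n`, then at least half of all `3q`-tuples are
injective and induce codegrees exceeding `q`. -/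
theorem exists_half_le_card_filter_codegree {ε : ℝ} (hε : 0 < ε) (hε' : ε ≤ 1 / 2) :
    ∃ q : ℕ, 0 < q ∧ ∃ n₀ : ℕ, ∀ n : ℕ, n₀ ≤ n → ∀ N : Fin n → Fin n → Finset (Fin n),
      (∀ a b, a ≠ b → (1 / 3 + ε) * n ≤ #(N a b)) →
        (1 / 2 : ℝ) * (n : ℝ) ^ (3 * q) ≤ #{f : Fin (3 * q) → Fin n | Function.Injective f ∧
          ∀ i j, i ≠ j → q < #{k | f k ∈ N (f i) (f j)}} := by
  obtain ⟨x, hx⟩ : ∃ x, x = 1 - ε / 2 := ⟨_, rfl⟩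
  obtain ⟨y, hy⟩ : ∃ y, y = 1 - (1 - x) * (1 / 3 + ε) := ⟨_, rfl⟩
  have hx0 : 0 < x := by linarith
  have hx1 : x ≤ 1 := by linarith
  have hy0 : 0 < y := by
    subst hy hx
    nlinarith
  have hyx : y ^ 3 < x := by
    subst hy hx
    have h₁ : 0 < ε / 2 * (1 / 3 + ε) := by positivity
    have h₂ : (1 / 3 + ε) ^ 2 < 1 := by nlinarith
    have h₃ : (ε / 2) ^ 2 * (1 / 3 + ε) ^ 2 ≤ (ε / 2) ^ 2 * 1 := by gcongr
    have h₄ : 0 < (ε / 2 * (1 / 3 + ε)) ^ 3 := by positivity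
    nlinarith
  have hr : |y ^ 3 / x| < 1 := by
    rw [abs_of_pos (by positivity), div_lt_one hx0]
    exact hyx
  obtain ⟨q, hq, hq0⟩ := (((tendsto_pow_const_mul_const_pow_of_abs_lt_one 2 hr).eventually_lt_const
    (show (0 : ℝ) < y ^ 2 / 36 by positivity)).and (Filter.eventually_gt_atTop 0)).exists
  refine ⟨q, hq0, 36 * q ^ 2, fun n hn N hN => ?_⟩
  have hn0 : (0 : ℝ) < n := by
    have : 0 < 36 * q ^ 2 := by positivity
    exact_mod_cast this.trans_le hn
  let G : Finset (Fin (3 * q) → Fin n) := {f | Function.Injective f ∧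
          ∀ i j, i ≠ j → q < #{k | f k ∈ N (f i) (f j)}}
  let I : Finset (Fin (3 * q) → Fin n) := {f | ¬ Function.Injective f}
  let B : Fin (3 * q) × Fin (3 * q) → Finset (Fin (3 * q) → Fin n) := fun p =>
    {f | f p.1 ≠ f p.2 ∧ #{k | f k ∈ N (f p.1) (f p.2)} ≤ q}
  have hI : (#I : ℝ) ≤ 1 / 4 * n ^ (3 * q) := by
    have h : (n : ℝ) * #I ≤ (3 * q) ^ 2 * n ^ (3 * q) := by
      have := card_mul_card_filter_not_injective (ι := Fin (3 * q)) (V := Fin n)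
      simp only [Fintype.card_fin] at this
      exact_mod_cast this
    have hn' : (36 * q ^ 2 : ℝ) ≤ n := by exact_mod_cast hn
    refine le_of_mul_le_mul_left (h.trans ?_) hn0
    calc (3 * q : ℝ) ^ 2 * n ^ (3 * q) = 36 * q ^ 2 * (1 / 4 * n ^ (3 * q)) := by ring
      _ ≤ _ := by gcongr
  have hB : ∀ p ∈ (univ : Finset (Fin (3 * q))).offDiag,
      (#(B p) : ℝ) ≤ (y ^ 3 / x) ^ q / y ^ 2 * n ^ (3 * q) := by
    intro p hp
    have h := pow_mul_card_filter_card_le (θ := 1 / 3 + ε) (i := p.1) (j := p.2)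
      (by simpa using hp) N hx0 hx1 (by simpa using hN) q
    simp only [Fintype.card_fin] at h
    rw [← hy, abs_of_pos (by positivity)] at h
    rw [div_pow, div_div, div_mul_eq_mul_div, le_div_iff₀ (by positivity)]
    obtain ⟨m, hm⟩ := Nat.exists_eq_add_of_le' (show 2 ≤ 3 * q by omega)
    rw [show 3 * q - 2 = m by omega] at h
    have hB' : x ^ q * (#(B p) : ℝ) ≤ n ^ 2 * (y * n) ^ m := h
    calc (#(B p) : ℝ) * (x ^ q * y ^ 2) = x ^ q * #(B p) * y ^ 2 := by ring
      _ ≤ n ^ 2 * (y * n) ^ m * y ^ 2 := by gcongr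
      _ = (y ^ 3) ^ q * n ^ (3 * q) := by rw [← pow_mul, hm]; ring
  have hBsum : (#((univ : Finset (Fin (3 * q))).offDiag.biUnion B) : ℝ) ≤ 1 / 4 * n ^ (3 * q) := by
    calc (#((univ : Finset (Fin (3 * q))).offDiag.biUnion B) : ℝ)
        ≤ ∑ p ∈ (univ : Finset (Fin (3 * q))).offDiag, (#(B p) : ℝ) := by
          exact_mod_cast card_biUnion_le
      _ ≤ #(univ : Finset (Fin (3 * q))).offDiag • ((y ^ 3 / x) ^ q / y ^ 2 * n ^ (3 * q) : ℝ) :=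
          sum_le_card_nsmul _ _ _ hB
      _ ≤ (3 * q) ^ 2 * ((y ^ 3 / x) ^ q / y ^ 2 * n ^ (3 * q) : ℝ) := by
          rw [nsmul_eq_mul]
          gcongr
          have : #(univ : Finset (Fin (3 * q))).offDiag ≤ (3 * q) ^ 2 := by
            rw [offDiag_card, card_univ, Fintype.card_fin, sq]
            exact Nat.sub_le _ _
          exact_mod_cast this
      _ = 9 * (q ^ 2 * (y ^ 3 / x) ^ q) / y ^ 2 * n ^ (3 * q) := by ring
      _ ≤ 9 * (y ^ 2 / 36) / y ^ 2 * n ^ (3 * q) := by gcongr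
      _ = _ := by
          field_simp
          norm_num
  have hcover : (univ : Finset (Fin (3 * q) → Fin n)) ⊆
      G ∪ (I ∪ (univ : Finset (Fin (3 * q))).offDiag.biUnion B) := by
    intro f _
    simp only [G, I, B, mem_union, mem_filter_univ, mem_biUnion, mem_offDiag, mem_univ, true_and]
    by_cases hf : Function.Injective f
    · by_cases h : ∀ i j, i ≠ j → q < #{k | f k ∈ N (f i) (f j)}
      · exact .inl ⟨hf, h⟩
      · push Not at h
        obtain ⟨i, j, hij, h⟩ := h
        exact .inr (.inr ⟨(i, j), hij, hf.ne hij, h⟩)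
    · exact .inr (.inl hf)
  have hcard : (n : ℝ) ^ (3 * q) ≤
      #G + (#I + #((univ : Finset (Fin (3 * q))).offDiag.biUnion B)) := by
    have h := (card_le_card hcover).trans
      ((card_union_le _ _).trans (Nat.add_le_add_left (card_union_le _ _) _))
    rw [card_univ, Fintype.card_fun, Fintype.card_fin, Fintype.card_fin] at h
    exact_mod_cast h
  change _ ≤ (#G : ℝ)
  linarith

/-- A dense family of injective tuples along which a fixed closed walk of length eleven stays
tight yields a genuine copy of the tight cycle. -/
theorem hasTightCycle_of_dense_walk (m : ℕ) {c : ℝ} (hc : 0 < c) :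
    ∃ n₀ : ℕ, ∀ n : ℕ, n₀ ≤ n → ∀ H : Finset (Finset (Fin n)), IsUniform3 H →
      ∀ g : ZMod 11 → Fin m,
        c * (n : ℝ) ^ m ≤ #{f : Fin m → Fin n | Function.Injective f ∧
          ∀ i, ({f (g (i - 1)), f (g i), f (g (i + 1))} : Finset (Fin n)) ∈ H} →
        HasTightCycle 11 H := by
  obtain ⟨n₀, h₀⟩ := exists_blowup 11 m c hc
  refine ⟨n₀, fun n hn H hH g hg => ?_⟩
  obtain ⟨F, hF, hFS⟩ := h₀ n hn _ hg
  simp only [mem_filter_univ] at hFS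
  let e : ZMod 11 ≃ Fin 11 := Fintype.equivFinOfCardEq (ZMod.card 11)
  have hne : ∀ i, g (i - 1) ≠ g i ∧ g i ≠ g (i + 1) ∧ g (i - 1) ≠ g (i + 1) := by
    intro i
    have h := hH _ ((hFS fun _ => e 0).2 i)
    refine ⟨fun h' => ?_, fun h' => ?_, fun h' => ?_⟩
    all_goals
      simp only [h', mem_insert, mem_singleton, or_true, true_or, insert_eq_of_mem] at h
      exact absurd h (card_le_two.trans_lt (by norm_num)).ne
  refine ⟨fun i => F (g i) (e i), fun i j hij => ?_, fun i => ?_⟩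
  · by_cases h : g i = g j
    · simp only [h] at hij
      exact e.injective (hF _ hij)
    · let s : Fin m → Fin 11 := Function.update (fun _ => e j) (g i) (e i)
      have hs := (hFS s).1 (a₁ := g i) (a₂ := g j)
        (by simpa [s, Function.update_of_ne (Ne.symm h)] using hij)
      exact absurd hs h
  · obtain ⟨h₁, h₂, h₃⟩ := hne i
    let s : Fin m → Fin 11 :=
      Function.update (Function.update (fun _ => e (i + 1)) (g i) (e i)) (g (i - 1)) (e (i - 1))
    simpa [s, h₁.symm, h₂.symm, h₃.symm] using (hFS s).2 i

theorem minCodeg_le_card_filter {V : Type*} [Fintype V] [DecidableEq V] (H : Finset (Finset V))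
    {u v : V} (huv : u ≠ v) : minCodeg H ≤ #{w | ({u, v, w} : Finset V) ∈ H} := by
  have h : minCodeg H ≤ codeg H u v := Nat.sInf_le ⟨u, v, huv, rfl⟩
  refine h.trans_eq ?_
  rw [codeg, Set.ncard_eq_toFinset_card', Set.toFinset_ofPred]

/-- For every `ε > 0` there exists `n₀` such that for every `n ≥ n₀`, every 3-uniform
hypergraph on `n` vertices with minimum codegree at least `(1/3 + ε)n` contains a copy
of the tight cycle `C₁₁` (on 11 distinct vertices) as a subgraph. -/
theorem codegree_copy_C11 :
    ∀ ε : ℝ, 0 < ε → ∃ n₀ : ℕ, ∀ n : ℕ, n₀ ≤ n →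
      ∀ H : Finset (Finset (Fin n)), IsUniform3 H →
        ((1 / 3 : ℝ) + ε) * n ≤ (minCodeg H : ℝ) →
          HasTightCycle 11 H := by
  intro ε hε
  obtain ⟨q, hq, n₁, h₁⟩ :=
    exists_half_le_card_filter_codegree (lt_min hε one_half_pos) (min_le_right ε (1 / 2))
  have : Nonempty (Fin (3 * q)) := ⟨⟨0, by omega⟩⟩
  have : Nontrivial (Fin (3 * q)) := Fin.nontrivial_iff_two_le.mpr (by omega)
  have hW : 0 < Fintype.card (ZMod 11 → Fin (3 * q)) := Fintype.card_pos
  obtain ⟨n₂, h₂⟩ := hasTightCycle_of_dense_walk (3 * q)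
    (c := 1 / 2 / Fintype.card (ZMod 11 → Fin (3 * q))) (by positivity)
  refine ⟨max n₁ n₂, fun n hn H hH hdeg => ?_⟩
  let N : Fin n → Fin n → Finset (Fin n) := fun a b => {c | ({a, b, c} : Finset (Fin n)) ∈ H}
  have hN : ∀ a b, a ≠ b → (1 / 3 + min ε (1 / 2)) * n ≤ #(N a b) := fun a b hab => by
    have h : (minCodeg H : ℝ) ≤ #(N a b) := by exact_mod_cast minCodeg_le_card_filter H hab
    refine le_trans ?_ (hdeg.trans h)
    gcongr
    exact min_le_left _ _
  have hG := h₁ n ((le_max_left _ _).trans hn) N hN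
  let S : (ZMod 11 → Fin (3 * q)) → Finset (Fin (3 * q) → Fin n) := fun g =>
    {f | Function.Injective f ∧
      ∀ i, ({f (g (i - 1)), f (g i), f (g (i + 1))} : Finset (Fin n)) ∈ H}
  have hsub : ({f : Fin (3 * q) → Fin n | Function.Injective f ∧
      ∀ i j, i ≠ j → q < #{k | f k ∈ N (f i) (f j)}} : Finset _) ⊆ univ.biUnion S := by
    intro f hf
    simp only [mem_filter_univ] at hf
    obtain ⟨hf, hcodeg⟩ := hf
    obtain ⟨g, hg⟩ := exists_closedWalk_eleven_of_codegree
      (fun i j k : Fin (3 * q) => ({f i, f j, f k} : Finset (Fin n)) ∈ H)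
      (fun i j k h => by rwa [Finset.insert_comm])
      (fun i j k h => by rwa [Finset.pair_comm])
      (fun i j k h hij => by
        have h := hH _ h
        rw [hij, Finset.insert_eq_of_mem (mem_insert_self _ _)] at h
        have := card_le_two (a := f j) (b := f k)
        omega)
      (fun i j hij => by
        have := hcodeg i j hij
        simp only [N, mem_filter_univ] at this
        rw [Fintype.card_fin]
        omega)
    simp only [S, mem_biUnion, mem_univ, true_and, mem_filter]
    exact ⟨g, hf, hg⟩
  obtain ⟨g, hg⟩ : ∃ g, 1 / 2 / (Fintype.card (ZMod 11 → Fin (3 * q)) : ℝ) * (n : ℝ) ^ (3 * q) ≤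
      #(S g) := by
    by_contra! hlt
    have hlt' := sum_lt_sum_of_nonempty univ_nonempty fun g (_ : g ∈ univ) => hlt g
    have hle : (#(univ.biUnion S) : ℝ) ≤ ∑ g, (#(S g) : ℝ) := by exact_mod_cast card_biUnion_le
    have hG' := hG.trans (Nat.cast_le.mpr (card_le_card hsub))
    rw [sum_const, card_univ, nsmul_eq_mul, ← mul_assoc, mul_div_cancel₀ _ (by positivity)] at hlt'
    linarith
  exact h₂ n ((le_max_right _ _).trans hn) H hH g hg
end

section
/- For every ε > 0 there exists n₀ such that for every n ≥ n₀ there exists a 3-uniform hypergraph H on n vertices containing no copy of the tight cycle C₁₁ as a subgraph and satisfying δ₂(H) ≥ (1/3 − ε)n. -/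
open Finset

/-- The 3-subsets of `Fin n` whose elements sum to `1` modulo `3`. -/
def sumOneMod3 (n : ℕ) : Finset (Finset (Fin n)) :=
  {e | e.card = 3 ∧ (∑ v ∈ e, v.val) % 3 = 1}

lemma isUniform3_sumOneMod3 (n : ℕ) : IsUniform3 (sumOneMod3 n) := by
  intro e he
  exact (Finset.mem_filter.1 he).2.1

lemma triple_mem_sumOneMod3 {n : ℕ} {u v w : Fin n} (huv : u ≠ v) (huw : u ≠ w) (hvw : v ≠ w) :
    ({u, v, w} : Finset (Fin n)) ∈ sumOneMod3 n ↔ (u.val + v.val + w.val) % 3 = 1 := by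
  have hcard : ({u, v, w} : Finset (Fin n)).card = 3 := Finset.card_eq_three.2
    ⟨u, v, w, huv, huw, hvw, rfl⟩
  have hsum : ∑ x ∈ ({u, v, w} : Finset (Fin n)), x.val = u.val + v.val + w.val := by
    rw [Finset.sum_insert (by simp [huv, huw]), Finset.sum_insert (by simp [hvw]),
      Finset.sum_singleton, add_assoc]
  simp [sumOneMod3, hcard, hsum]

lemma not_hasTightCycle_sumOneMod3 (n : ℕ) : ¬ HasTightCycle 11 (sumOneMod3 n) := by
  rintro ⟨x, hx, h⟩
  have hsum (i : ZMod 11) : ((x (i - 1)).val + (x i).val + (x (i + 1)).val) % 3 = 1 := by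
    refine (triple_mem_sumOneMod3 ?_ ?_ ?_).1 (h i) <;> refine hx.ne ?_ <;> revert i <;> decide
  have hstep (i : ZMod 11) : (x (i + 3)).val % 3 = (x i).val % 3 := by
    have h1 := hsum (i + 1)
    have h2 := hsum (i + 2)
    rw [show i + 1 - 1 = i by ring, show i + 1 + 1 = i + 2 by ring] at h1
    rw [show i + 2 - 1 = i + 1 by ring, show i + 2 + 1 = i + 3 by ring] at h2
    omega
  have hsucc (i : ZMod 11) : (x (i + 1)).val % 3 = (x i).val % 3 := by
    rw [show i + 1 = i + 3 + 3 + 3 + 3 by revert i; decide]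
    simp only [hstep]
  have h0 := hsum 0
  have h1 := hsucc 0
  have h2 := hsucc (0 - 1)
  rw [sub_add_cancel] at h2
  omega

lemma div_three_le_card_mod_three (n r : ℕ) (hr : r < 3) :
    n / 3 ≤ ({w : Fin n | w.val % 3 = r} : Finset (Fin n)).card := by
  rw [← Finset.card_fin (n / 3)]
  refine Finset.card_le_card_of_injOn
    (fun k : Fin (n / 3) => (⟨3 * k.val + r, by omega⟩ : Fin n)) ?_ ?_
  · intro k _
    simp only [Finset.coe_filter, Finset.mem_univ, true_and, Set.mem_ofPred_eq]
    omega
  · intro k _ l _ hkl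
    simp only [Fin.mk.injEq] at hkl
    exact Fin.ext (by omega)

lemma le_codeg_sumOneMod3 {n : ℕ} {u v : Fin n} (huv : u ≠ v) :
    n / 3 - 2 ≤ codeg (sumOneMod3 n) u v := by
  set r := (1 + 2 * u.val + 2 * v.val) % 3 with hr
  set S : Finset (Fin n) := {w : Fin n | w.val % 3 = r}
  have hS : n / 3 ≤ S.card := div_three_le_card_mod_three n r (by omega)
  have hsub : ((S \ {u, v} : Finset (Fin n)) : Set (Fin n)) ⊆
      {w | ({u, v, w} : Finset (Fin n)) ∈ sumOneMod3 n} := by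
    intro w hw
    simp only [S, Finset.mem_coe, Finset.mem_sdiff, Finset.mem_filter, Finset.mem_univ, true_and,
      Finset.mem_insert, Finset.mem_singleton, not_or] at hw
    obtain ⟨hw, hwu, hwv⟩ := hw
    exact (triple_mem_sumOneMod3 huv (Ne.symm hwu) (Ne.symm hwv)).2 (by omega)
  have hle := Set.ncard_le_ncard hsub (Set.toFinite _)
  rw [Set.ncard_coe_finset] at hle
  have hsd := Finset.le_card_sdiff {u, v} S
  rw [Finset.card_pair huv] at hsd
  unfold codeg
  omega

lemma le_minCodeg_sumOneMod3 {n : ℕ} (hn : 2 ≤ n) : n / 3 - 2 ≤ minCodeg (sumOneMod3 n) := by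
  have hne : {d : ℕ | ∃ u v : Fin n, u ≠ v ∧ codeg (sumOneMod3 n) u v = d}.Nonempty :=
    ⟨_, ⟨0, by omega⟩, ⟨1, by omega⟩, by simp, rfl⟩
  obtain ⟨u, v, huv, h⟩ := Nat.sInf_mem hne
  unfold minCodeg
  rw [← h]
  exact le_codeg_sumOneMod3 huv

/-- For every `ε > 0` there exists `n₀` such that for every `n ≥ n₀` there is a 3-uniform
hypergraph on `n` vertices with no copy of the tight cycle `C₁₁` and minimum codegree at
least `(1/3 - ε)n`. -/
theorem codegree_lower_bound_C11 :
    ∀ ε : ℝ, 0 < ε → ∃ n₀ : ℕ, ∀ n : ℕ, n₀ ≤ n →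
      ∃ H : Finset (Finset (Fin n)), IsUniform3 H ∧ ¬ HasTightCycle 11 H ∧
        ((1 / 3 : ℝ) - ε) * n ≤ (minCodeg H : ℝ) := by
  intro ε hε
  refine ⟨⌈3 / ε⌉₊ + 2, fun n hn => ⟨sumOneMod3 n, isUniform3_sumOneMod3 n,
    not_hasTightCycle_sumOneMod3 n, ?_⟩⟩
  have hdeg := le_minCodeg_sumOneMod3 (n := n) (by omega)
  have hdeg' : (n : ℝ) ≤ 3 * minCodeg (sumOneMod3 n) + 8 := by
    exact_mod_cast (by omega : n ≤ 3 * minCodeg (sumOneMod3 n) + 8)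
  have hεn : 3 ≤ n * ε := by
    rw [← div_le_iff₀ hε]
    exact Nat.ceil_le.1 (by omega)
  linarith
end

section
/- Let H be a 3-uniform hypergraph and let {x,y} be a pair of distinct vertices that is both an apex pair and a base pair of H. Then H contains a homomorphic copy of the tight cycle C₁₁. -/
open Finset

theorem HasHomTightCycle.of_forall_mem {V : Type*} [DecidableEq V] {ℓ : ℕ}
    {H : Finset (Finset V)} (hH : IsUniform3 H) (f : ZMod ℓ → V)
    (hf : ∀ i, ({f (i - 1), f i, f (i + 1)} : Finset V) ∈ H) : HasHomTightCycle ℓ H := by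
  refine ⟨f, fun i => ?_⟩
  obtain ⟨h₁, h₂, h₃⟩ := Finset.card_triple_eq_three_iff.mp (hH _ (hf i))
  exact ⟨h₁, h₃, h₂, hf i⟩

theorem BasePair.symm {V : Type*} [DecidableEq V] {H : Finset (Finset V)} {x y : V}
    (h : BasePair H x y) : BasePair H y x := by
  obtain ⟨w, c, hcard, h₁, h₂, h₃⟩ := h
  refine ⟨w, c, ?_, ?_, h₃, h₂⟩
  · rwa [Finset.insert_comm]
  · rwa [Finset.pair_comm]

theorem HasHomTightCycle.of_arcD_of_basePair {V : Type*} [DecidableEq V]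
    {H : Finset (Finset V)} (hH : IsUniform3 H) {x y : V}
    (hapex : ArcD H x y) (hbase : BasePair H x y) : HasHomTightCycle 11 H := by
  obtain ⟨a, b, -, hyxa, hyxb, hyab⟩ := hapex
  obtain ⟨w, c, -, hwxy, hwxc, hwyc⟩ := hbase
  have rot : ∀ {p q r : V}, ({p, q, r} : Finset V) ∈ H → ({q, r, p} : Finset V) ∈ H := by
    intro p q r h
    convert h using 1
    grind
  have flip : ∀ {p q r : V}, ({p, q, r} : Finset V) ∈ H → ({r, q, p} : Finset V) ∈ H := by
    intro p q r h
    convert h using 1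
    grind
  let f : Fin 11 → V := ![x, y, w, x, c, w, y, x, a, y, b]
  refine HasHomTightCycle.of_forall_mem hH f fun (i : Fin 11) => ?_
  fin_cases i
  · exact flip hyxb
  · exact rot hwxy
  · exact rot (rot hwxy)
  · exact hwxc
  · exact rot hwxc
  · exact rot (rot hwyc)
  · exact flip (rot hwxy)
  · exact hyxa
  · exact rot hyxa
  · exact flip (rot (rot hyab))
  · exact flip (rot hyxb)

/-- If a pair `{x,y}` of distinct vertices is both an apex pair and a base pair of `H`,
then `H` contains a homomorphic copy of the tight cycle `C₁₁`. -/
theorem apex_and_base_pair_gives_homC11 {V : Type*} [DecidableEq V]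
    (H : Finset (Finset V)) (hH : IsUniform3 H) (x y : V) (hxy : x ≠ y)
    (hapex : ArcD H x y ∨ ArcD H y x) (hbase : BasePair H x y) :
    HasHomTightCycle 11 H := by
  rcases hapex with h | h
  · exact HasHomTightCycle.of_arcD_of_basePair hH h hbase
  · exact HasHomTightCycle.of_arcD_of_basePair hH h hbase.symm
end

section
/- Let H be a 3-uniform hypergraph containing an edge {x,y,z} such that some K₄⁻ of H contains x and y with apex x, and some K₄⁻ of H contains y and z with apex y (i.e., the arcs y → x and z → y both lie in the apex digraph D). Then H contains a homomorphic copy of the tight cycle C₁₁. -/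
open Finset

/-- In a 3-uniform hypergraph, the distinctness conditions of a homomorphic tight cycle are
automatic. -/
theorem IsUniform3.hasHomTightCycle {V : Type*} [DecidableEq V] {H : Finset (Finset V)}
    (hH : IsUniform3 H) {l : ℕ} (x : ZMod l → V)
    (hx : ∀ i, ({x (i - 1), x i, x (i + 1)} : Finset V) ∈ H) : HasHomTightCycle l H := by
  refine ⟨x, fun i => ?_⟩
  have hcard := hH _ (hx i)
  refine ⟨fun h => ?_, fun h => ?_, fun h => ?_, hx i⟩ <;>
    grind [Finset.card_le_two]

/-- If `{x,y,z}` is an edge of `H` and the apex digraph contains the arcs `y → x` and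
`z → y`, then `H` contains a homomorphic copy of the tight cycle `C₁₁`. -/
theorem consecutive_arcs_give_homC11 {V : Type*} [DecidableEq V]
    (H : Finset (Finset V)) (hH : IsUniform3 H) (x y z : V)
    (hxy : x ≠ y) (hxz : x ≠ z) (hyz : y ≠ z)
    (he : ({x, y, z} : Finset V) ∈ H)
    (h1 : ArcD H y x) (h2 : ArcD H z y) :
    HasHomTightCycle 11 H := by
  obtain ⟨a, b, -, hxya, hxyb, hxab⟩ := h1
  obtain ⟨c, d, -, hyzc, hyzd, hycd⟩ := h2
  have swap (u v w : V) : ({u, v, w} : Finset V) = {v, u, w} := Finset.insert_comm u v {w}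
  have swap' (u v w : V) : ({u, v, w} : Finset V) = {u, w, v} := by rw [Finset.pair_comm]
  refine hH.hasHomTightCycle (l := 11) ![x, y, z, c, y, d, z, y, x, a, b] fun i => ?_
  fin_cases i
  · change ({b, x, y} : Finset V) ∈ H
    rwa [swap, swap']
  · exact he
  · exact hyzc
  · change ({z, c, y} : Finset V) ∈ H
    rwa [swap', swap]
  · change ({c, y, d} : Finset V) ∈ H
    rwa [swap]
  · change ({y, d, z} : Finset V) ∈ H
    rwa [swap']
  · change ({d, z, y} : Finset V) ∈ H
    rwa [swap', swap, swap']
  · change ({z, y, x} : Finset V) ∈ H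
    rwa [swap', swap, swap']
  · change ({y, x, a} : Finset V) ∈ H
    rwa [swap]
  · exact hxab
  · change ({a, b, x} : Finset V) ∈ H
    rwa [swap', swap]
end
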